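/- arXiv:1208.6074 — 8 statements merged into one kernel-verified Lean document; each statement's English description precedes it below -/
import Mathlib

section
/- Let K be a field, let n ≥ 1, let a_1, …, a_n be positive integers, let u_1, …, u_n ∈ K, let k be a natural number, and let p, P, A_1, …, A_n ∈ K[X] be polynomials with deg p < k. Consider the rational function E = P + p/X^k + Σ_{i=1}^n A_i/(1 − u_i X^{a_i}) in RatFunc K. Then the coefficient of X^0 of the formal Laurent series expansion of E (i.e., of the image of E under the canonical embedding of RatFunc K into the field of formal Laurent series LaurentSeries K) equals P(0) + Σ_{i=1}^n A_i(0). -/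
open Polynomial

section LaurentExpansion

variable {K : Type*} [Field K]

theorem ratFunc_coe_algebraMap (q : K[X]) :
    ((algebraMap K[X] (RatFunc K) q : RatFunc K) : LaurentSeries K)
      = ((q : PowerSeries K) : LaurentSeries K) :=
  (RatFunc.coe_coe q).symm

theorem laurentSeries_coeff_zero_polynomial (q : K[X]) :
    ((algebraMap K[X] (RatFunc K) q : RatFunc K) : LaurentSeries K).coeff 0 = q.eval 0 := by
  rw [ratFunc_coe_algebraMap]
  have h := LaurentSeries.coeff_coe_powerSeries (q : PowerSeries K) 0
  rw [Nat.cast_zero] at h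
  rw [h, Polynomial.coeff_coe, Polynomial.coeff_zero_eq_eval_zero]

/-- Dividing by a polynomial with constant term `1` preserves the constant term. -/
theorem laurentSeries_coeff_zero_div (q d : K[X]) (hd : d.coeff 0 = 1) :
    ((algebraMap K[X] (RatFunc K) q / algebraMap K[X] (RatFunc K) d : RatFunc K) :
      LaurentSeries K).coeff 0 = q.eval 0 := by
  have hd0 : PowerSeries.constantCoeff (d : PowerSeries K) = 1 := by
    rw [← PowerSeries.coeff_zero_eq_constantCoeff_apply, Polynomial.coeff_coe, hd]
  have hmul : (d : PowerSeries K) * (d : PowerSeries K)⁻¹ = 1 :=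
    PowerSeries.mul_inv_cancel _ (by rw [hd0]; exact one_ne_zero)
  have hmul' : ((d : PowerSeries K) : LaurentSeries K)
      * (((d : PowerSeries K)⁻¹ : PowerSeries K) : LaurentSeries K) = 1 := by
    rw [← PowerSeries.coe_mul, hmul, PowerSeries.coe_one]
  have hquot : ((algebraMap K[X] (RatFunc K) q / algebraMap K[X] (RatFunc K) d : RatFunc K) :
      LaurentSeries K)
        = (((q : PowerSeries K) * (d : PowerSeries K)⁻¹ : PowerSeries K) : LaurentSeries K) := by
    rw [map_div₀, ratFunc_coe_algebraMap, ratFunc_coe_algebraMap,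
      div_eq_iff (left_ne_zero_of_mul_eq_one hmul'), PowerSeries.coe_mul, mul_assoc,
      mul_comm (((d : PowerSeries K)⁻¹ : PowerSeries K) : LaurentSeries K), hmul', mul_one]
  have h := LaurentSeries.coeff_coe_powerSeries ((q : PowerSeries K) * (d : PowerSeries K)⁻¹) 0
  rw [Nat.cast_zero] at h
  rw [hquot, h, PowerSeries.coeff_zero_eq_constantCoeff_apply, map_mul,
    PowerSeries.constantCoeff_inv, hd0, inv_one, mul_one,
    ← PowerSeries.coeff_zero_eq_constantCoeff_apply, Polynomial.coeff_coe,
    Polynomial.coeff_zero_eq_eval_zero]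

/-- The constant term of `q / X ^ k` is the coefficient of `X ^ k` in `q`. -/
theorem laurentSeries_coeff_zero_div_X_pow (q : K[X]) (k : ℕ) :
    ((algebraMap K[X] (RatFunc K) q / algebraMap K[X] (RatFunc K) (X ^ k) : RatFunc K) :
      LaurentSeries K).coeff 0 = q.coeff k := by
  set f : LaurentSeries K :=
    ((algebraMap K[X] (RatFunc K) q / algebraMap K[X] (RatFunc K) (X ^ k) : RatFunc K) :
      LaurentSeries K) with hf
  have hX : algebraMap K[X] (RatFunc K) (X ^ k) ≠ 0 :=
    RatFunc.algebraMap_ne_zero (pow_ne_zero k X_ne_zero)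
  have hmul : HahnSeries.single (k : ℤ) (1 : K) * f = ((q : PowerSeries K) : LaurentSeries K) := by
    rw [RatFunc.single_one_eq_pow, ← RatFunc.coe_X, ← map_pow, hf, ← RatFunc.algebraMap_X,
      ← map_pow, ← map_mul, mul_div_cancel₀ _ hX, ratFunc_coe_algebraMap]
  have h := HahnSeries.coeff_single_mul_add (r := (1 : K)) (x := f) (a := 0) (b := (k : ℤ))
  rw [zero_add, hmul, one_mul] at h
  rw [← h, LaurentSeries.coeff_coe_powerSeries, Polynomial.coeff_coe]

end LaurentExpansion

/-- Single-variable instance of Lemma 4.1 (formula (9)): the constant term of the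
Laurent series expansion of `E = P + p/X^k + ∑ A_i/(1 - u_i X^(a_i))` equals
`P(0) + ∑ A_i(0)`. -/
theorem stmt_0 (K : Type*) [Field K] (n : ℕ) (hn : 1 ≤ n)
    (a : Fin n → ℕ) (ha : ∀ i, 0 < a i) (u : Fin n → K) (k : ℕ)
    (p P : K[X]) (A : Fin n → K[X]) (hp : p.degree < k)
    (E : RatFunc K)
    (hE : E = algebraMap K[X] (RatFunc K) P
        + algebraMap K[X] (RatFunc K) p / algebraMap K[X] (RatFunc K) (X ^ k)
        + ∑ i, algebraMap K[X] (RatFunc K) (A i)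
            / algebraMap K[X] (RatFunc K) (1 - C (u i) * X ^ (a i))) :
    (E : LaurentSeries K).coeff 0 = P.eval 0 + ∑ i, (A i).eval 0 := by
  have hcoe : ∀ i, (1 - C (u i) * X ^ a i : K[X]).coeff 0 = 1 := fun i ↦ by
    simp [coeff_X_pow, (ha i).ne]
  rw [hE, map_add, map_add, map_sum, HahnSeries.coeff_add, HahnSeries.coeff_add,
    HahnSeries.coeff_sum, laurentSeries_coeff_zero_polynomial,
    laurentSeries_coeff_zero_div_X_pow, coeff_eq_zero_of_degree_lt hp, add_zero]
  exact congrArg _ (Finset.sum_congr rfl fun i _ ↦ laurentSeries_coeff_zero_div _ _ (hcoe i))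
end

section
/- Let K be a field, let a, b ≥ 1 be integers, and let u, v ∈ K with u ≠ 0 and u^b ≠ v^a. Then in the quotient ring K[X]/(1 − u X^a), the class of 1 − v X^b is a unit, and its inverse is the class of (u^b/(u^b − v^a)) · Σ_{j=0}^{a−1} v^j X^{jb}; equivalently, the polynomial (1 − v X^b) · (u^b/(u^b − v^a)) · Σ_{j=0}^{a−1} v^j X^{jb} − 1 is divisible by 1 − u X^a in K[X]. -/
open Polynomial

/-- The product of `1 - v X^b` with its explicit inverse modulo `1 - u X^a`, minus one. -/
theorem one_sub_mul_geom_sum_sub_one {K : Type*} [Field K] (a b : ℕ) (u v : K)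
    (huv : u ^ b ≠ v ^ a) :
    (1 - C v * X ^ b) * (C (u ^ b / (u ^ b - v ^ a)) *
        ∑ j ∈ Finset.range a, C (v ^ j) * X ^ (j * b)) - 1 =
      C (v ^ a / (u ^ b - v ^ a)) * (1 - (C u * X ^ a : K[X]) ^ b) := by
  have hne : u ^ b - v ^ a ≠ 0 := sub_ne_zero.mpr huv
  have hgeom : (1 - C v * X ^ b : K[X]) * ∑ j ∈ Finset.range a, C (v ^ j) * X ^ (j * b) =
      1 - C (v ^ a) * X ^ (a * b) := by
    have h := mul_neg_geom_sum (C v * X ^ b : K[X]) a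
    simpa only [mul_pow, ← C_pow, ← pow_mul, mul_comm b] using h
  have hc : u ^ b / (u ^ b - v ^ a) = v ^ a / (u ^ b - v ^ a) + 1 := by
    field_simp
    ring
  have hd : u ^ b / (u ^ b - v ^ a) * v ^ a = v ^ a / (u ^ b - v ^ a) * u ^ b := by
    ring
  rw [mul_left_comm, hgeom, mul_sub, mul_one, ← mul_assoc, ← C_mul, hd, hc, C_add, C_1, C_mul,
    mul_pow, ← C_pow, ← pow_mul]
  ring

/-- Section 4.2: the explicit inverse of the class of `1 - v X^b` in
`K[X]/(1 - u X^a)` is the class of `(u^b/(u^b - v^a)) ∑_{j<a} v^j X^{jb}`. -/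
theorem stmt_4 (K : Type*) [Field K] (a b : ℕ) (ha : 1 ≤ a) (hb : 1 ≤ b)
    (u v : K) (hu : u ≠ 0) (huv : u ^ b ≠ v ^ a) :
    IsUnit (Ideal.Quotient.mk (Ideal.span {(1 - C u * X ^ a : K[X])})
        (1 - C v * X ^ b)) ∧
      (1 - C u * X ^ a : K[X]) ∣
        ((1 - C v * X ^ b) * (C (u ^ b / (u ^ b - v ^ a)) *
            ∑ j ∈ Finset.range a, C (v ^ j) * X ^ (j * b)) - 1) := by
  have hdvd : (1 - C u * X ^ a : K[X]) ∣
      (1 - C v * X ^ b) * (C (u ^ b / (u ^ b - v ^ a)) *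
        ∑ j ∈ Finset.range a, C (v ^ j) * X ^ (j * b)) - 1 := by
    rw [one_sub_mul_geom_sum_sub_one a b u v huv]
    exact (one_sub_dvd_one_sub_pow _ b).mul_left _
  refine ⟨IsUnit.of_mul_eq_one (Ideal.Quotient.mk _ (C (u ^ b / (u ^ b - v ^ a)) *
    ∑ j ∈ Finset.range a, C (v ^ j) * X ^ (j * b))) ?_, hdvd⟩
  rw [← map_mul, ← map_one (Ideal.Quotient.mk _), Ideal.Quotient.mk_eq_mk_iff_sub_mem]
  exact Ideal.mem_span_singleton.mpr hdvd
end

section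
/- There exist no natural numbers x_1, x_2, x_3 satisfying 12223·x_1 + 12224·x_2 + 36671·x_3 = 149389505; i.e., the polytope P = {x ∈ ℝ^3 : 12223 x_1 + 12224 x_2 + 36671 x_3 = 149389505, x ≥ 0} contains no integer lattice points. -/
/-- Example 5.2 (Aardal–Lenstra): the knapsack equation
`12223 x₁ + 12224 x₂ + 36671 x₃ = 149389505` has no solution in natural numbers. -/
theorem stmt_10 :
    ¬ ∃ x₁ x₂ x₃ : ℕ, 12223 * x₁ + 12224 * x₂ + 36671 * x₃ = 149389505 := by
  rintro ⟨x₁, x₂, x₃, h⟩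
  -- The equation reads `12223 * s + t = 12223 * 12222 - 1` with `s = x₁ + x₂ + 3 * x₃` and
  -- `t = x₂ + 2 * x₃ ≤ s`: it forces `s ≤ 12221`, hence `12222 ≤ t`.
  rcases le_or_gt (x₁ + x₂ + 3 * x₃) 12221 with hs | hs <;> linarith
end

section
/- There exist no natural numbers x_1, x_2, x_3, x_4, x_5 satisfying 12223·x_1 + 12224·x_2 + 36674·x_3 + 61119·x_4 + 85569·x_5 = 89643481; i.e., the 4-dimensional polytope {x ∈ ℝ^5 : 12223 x_1 + 12224 x_2 + 36674 x_3 + 61119 x_4 + 85569 x_5 = 89643481, x ≥ 0} contains no integer lattice points. -/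
/-- Hard Aardal–Lenstra instance of Section 5.1: the knapsack equation
`12223 x₁ + 12224 x₂ + 36674 x₃ + 61119 x₄ + 85569 x₅ = 89643481`
has no solution in natural numbers. -/
theorem stmt_11 :
    ¬ ∃ x₁ x₂ x₃ x₄ x₅ : ℕ,
      12223 * x₁ + 12224 * x₂ + 36674 * x₃ + 61119 * x₄ + 85569 * x₅ = 89643481 := by
  rintro ⟨x₁, x₂, x₃, x₄, x₅, h⟩
  -- Decompose the coefficients as `12223 * (1, 1, 3, 5, 7) + (0, 1, 5, 4, 8)`.
  obtain ⟨u, hu⟩ : ∃ u, u = x₁ + x₂ + 3 * x₃ + 5 * x₄ + 7 * x₅ := ⟨_, rfl⟩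
  obtain ⟨v, hv⟩ : ∃ v, v = x₂ + 5 * x₃ + 4 * x₄ + 8 * x₅ := ⟨_, rfl⟩
  have huv : 12223 * u + v = 89643481 := by rw [← h, hu, hv]; ring
  clear h
  have hle : 3 * v ≤ 5 * u := by omega
  clear hu hv
  -- The equation forces `u ≤ 7333`, hence `v ≥ 12222 > 5 / 3 * u`.
  have hu : u ≤ 7333 := by
    by_contra! hlt
    have : 7334 ≤ u := hlt
    linarith
  linarith
end

section
/- The number of 5-tuples (x_1, x_2, x_3, x_4, x_5) of natural numbers satisfying 12223·x_1 + 12224·x_2 + 36674·x_3 + 61119·x_4 + 85569·x_5 = 89643481 × 1001 is exactly 94267024658624993843. -/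
open Finset PowerSeries

/-- `denumerant l n` is the number of ways of writing `n` as a combination of the entries of `l`
with natural-number coefficients, when these entries are positive. -/
def denumerant : List ℕ → ℕ → ℕ
  | [], n => if n = 0 then 1 else 0
  | a :: l, n => ∑ x ∈ range (n / a + 1), denumerant l (n - a * x)

theorem denumerant_cons (a : ℕ) (l : List ℕ) (n : ℕ) :
    denumerant (a :: l) n = ∑ x ∈ range (n / a + 1), denumerant l (n - a * x) := rfl

theorem denumerant_cons_of_lt {a n : ℕ} (l : List ℕ) (h : n < a) :
    denumerant (a :: l) n = denumerant l n := by
  simp [denumerant_cons, Nat.div_eq_of_lt h]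

theorem denumerant_cons_of_le {a n : ℕ} (l : List ℕ) (ha : 0 < a) (h : a ≤ n) :
    denumerant (a :: l) n = denumerant l n + denumerant (a :: l) (n - a) := by
  have hdiv : n / a = (n - a) / a + 1 := by
    rw [Nat.div_eq_sub_div ha h]
  rw [denumerant_cons, sum_range_succ', hdiv, denumerant_cons, add_comm]
  simp only [mul_zero, Nat.sub_zero, mul_add, mul_one, Nat.add_comm _ a, Nat.sub_add_eq]

section Counting

theorem finite_ncard_linear (b : ℕ) (hb : 0 < b) (n : ℕ) :
    {y : ℕ | b * y = n}.Finite ∧ {y : ℕ | b * y = n}.ncard = denumerant [b] n := by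
  have hden : denumerant [b] n = if b ∣ n then 1 else 0 := by
    induction n using Nat.strong_induction_on with
    | _ n ih =>
      rcases lt_or_ge n b with h | h
      · rw [denumerant_cons_of_lt _ h]
        rcases Nat.eq_zero_or_pos n with rfl | hn
        · simp [denumerant]
        · simp [denumerant, hn.ne', Nat.not_dvd_of_pos_of_lt hn h]
      · rw [denumerant_cons_of_le _ hb h, ih _ (by omega)]
        simp [denumerant, (hb.trans_le h).ne', Nat.dvd_sub_iff_left h dvd_rfl]
  rw [hden]
  split_ifs with h
  · obtain ⟨k, rfl⟩ := h
    have : {y : ℕ | b * y = b * k} = {k} := by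
      ext y
      simp [hb.ne']
    rw [this]
    exact ⟨Set.finite_singleton k, Set.ncard_singleton k⟩
  · have : {y : ℕ | b * y = n} = ∅ := by
      ext y
      simp only [Set.mem_ofPred_eq, Set.mem_empty_iff_false, iff_false]
      rintro rfl
      exact h ⟨y, rfl⟩
    simp [this]

theorem finite_ncard_prod {α : Type*} {f : α → ℕ} {l : List ℕ} {a : ℕ} (ha : 0 < a)
    (hf : ∀ n, {y | f y = n}.Finite ∧ {y | f y = n}.ncard = denumerant l n) (n : ℕ) :
    {x : ℕ × α | a * x.1 + f x.2 = n}.Finite ∧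
      {x : ℕ × α | a * x.1 + f x.2 = n}.ncard = denumerant (a :: l) n := by
  let s := (range (n / a + 1)).sigma fun i => (hf (n - a * i)).1.toFinset
  let e : (_ : ℕ) × α ↪ ℕ × α := (Equiv.sigmaEquivProd ℕ α).toEmbedding
  have hs : {x : ℕ × α | a * x.1 + f x.2 = n} = ↑(s.map e) := by
    ext ⟨i, y⟩
    have hi : i < n / a + 1 ↔ a * i ≤ n := by
      rw [Nat.lt_succ_iff, Nat.le_div_iff_mul_le ha, mul_comm]
    simp only [Set.mem_ofPred_eq, coe_map, Set.mem_image, mem_coe, s, e, mem_sigma, mem_range,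
      Set.Finite.mem_toFinset, Equiv.coe_toEmbedding, Sigma.exists, Equiv.sigmaEquivProd_apply,
      Prod.mk.injEq]
    constructor
    · intro h
      exact ⟨i, y, ⟨by omega, by omega⟩, rfl, rfl⟩
    · rintro ⟨_, _, ⟨h₁, h₂⟩, rfl, rfl⟩
      omega
  rw [hs]
  refine ⟨finite_toSet _, ?_⟩
  rw [Set.ncard_coe_finset, card_map, card_sigma, denumerant_cons]
  refine sum_congr rfl fun i _ => ?_
  exact (Set.ncard_eq_toFinset_card _ (hf _).1).symm.trans (hf _).2

end Counting

section Scaling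

theorem denumerant_map_mul {b : ℕ} (hb : 0 < b) (l : List ℕ) (n : ℕ) :
    denumerant (l.map (b * ·)) n = if b ∣ n then denumerant l (n / b) else 0 := by
  induction l generalizing n with
  | nil =>
    rcases Nat.eq_zero_or_pos n with rfl | hn
    · simp [denumerant]
    · by_cases h : b ∣ n
      · simp [denumerant, hn.ne', h, hb.ne', Nat.not_lt.2 (Nat.le_of_dvd hn h)]
      · simp [denumerant, hn.ne', h]
  | cons a l ih =>
    have hle : ∀ x ∈ range (n / (b * a) + 1), b * a * x ≤ n := fun x hx =>
      (Nat.mul_le_mul_left _ (Nat.lt_succ_iff.1 (mem_range.1 hx))).trans (Nat.mul_div_le _ _)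
    rw [List.map_cons, denumerant_cons]
    split_ifs with h
    · obtain ⟨k, rfl⟩ := h
      rw [Nat.mul_div_cancel_left _ hb, Nat.mul_div_mul_left _ _ hb, denumerant_cons]
      refine sum_congr rfl fun x _ => ?_
      rw [ih, mul_assoc, ← Nat.mul_sub, if_pos (dvd_mul_right _ _), Nat.mul_div_cancel_left _ hb]
    · refine sum_eq_zero fun x hx => ?_
      rw [ih, if_neg]
      intro hd
      refine h ((Nat.dvd_sub_iff_left (hle x hx) ?_).1 hd)
      exact ⟨a * x, mul_assoc _ _ _⟩

theorem denumerant_cons_map_mul {a b x : ℕ} (ha : 0 < a) (hab : a.Coprime b) (hx : x < b)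
    (l : List ℕ) (j : ℕ) :
    denumerant (a :: l.map (b * ·)) (a * x + b * j) = denumerant (a :: l) j := by
  have hb : 0 < b := by omega
  rw [denumerant_cons, denumerant_cons]
  symm
  have key : ∀ k ∈ range (j / a + 1), a * k ≤ j := fun k hk =>
    (Nat.mul_le_mul_left _ (Nat.lt_succ_iff.1 (mem_range.1 hk))).trans (Nat.mul_div_le _ _)
  refine sum_of_injOn (fun k => x + b * k) ?_ ?_ ?_ ?_
  · intro k _ k' _ h
    simpa [hb.ne'] using h
  · intro k hk
    have := key k hk
    simp only [coe_range, Set.mem_Iio, Nat.lt_succ_iff, Nat.le_div_iff_mul_le ha]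
    nlinarith
  · intro y hy hn
    rw [denumerant_map_mul hb, if_neg]
    intro hd
    apply hn
    rw [mem_range, Nat.lt_succ_iff, Nat.le_div_iff_mul_le ha] at hy
    obtain ⟨c, hc⟩ := hd
    have hc' : a * y + b * c = a * x + b * j := by
      rw [← hc, mul_comm a y]
      omega
    have hmod : x ≡ y [MOD b] := by
      refine Nat.ModEq.cancel_left_of_coprime (c := a) hab.symm ?_
      have : (a * y + b * c) % b = (a * x + b * j) % b := by rw [hc']
      simpa [Nat.ModEq] using this.symm
    have hxy : y % b = x := by rw [← hmod, Nat.mod_eq_of_lt hx]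
    have hy' : x + b * (y / b) = y := by
      rw [← hxy]
      exact Nat.mod_add_div y b
    refine ⟨y / b, ?_, hy'⟩
    rw [mem_coe, mem_range, Nat.lt_succ_iff, Nat.le_div_iff_mul_le ha]
    rw [← hy'] at hc'
    have : b * (y / b * a + c) = b * j := by linarith
    have := Nat.eq_of_mul_eq_mul_left hb this
    omega
  · intro k hk
    have := key k hk
    have h : a * x + b * j - a * (x + b * k) = b * (j - a * k) := by
      rw [Nat.mul_sub, mul_add, Nat.add_sub_add_left, mul_left_comm]
    simp only [h, denumerant_map_mul hb, dvd_mul_right, if_true, Nat.mul_div_cancel_left _ hb]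

end Scaling

section GeneratingFunction

/-- The generating function of the denumerant of `l`. -/
noncomputable def denumerantSeries (l : List ℕ) : ℤ⟦X⟧ :=
  PowerSeries.mk fun n => (denumerant l n : ℤ)

theorem coeff_X_pow_mul_denumerantSeries {e n : ℕ} (h : e ≤ n) (l : List ℕ) :
    coeff n ((X : ℤ⟦X⟧) ^ e * denumerantSeries l) = denumerant l (n - e) := by
  simp [coeff_X_pow_mul', h, denumerantSeries]

theorem denumerantSeries_nil : denumerantSeries [] = 1 := by
  ext n
  simp [denumerantSeries, denumerant, coeff_one]

theorem one_sub_X_pow_mul_denumerantSeries {a : ℕ} (ha : 0 < a) (l : List ℕ) :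
    (1 - X ^ a) * denumerantSeries (a :: l) = denumerantSeries l := by
  ext n
  rw [sub_mul, one_mul, map_sub, coeff_X_pow_mul']
  simp only [denumerantSeries, coeff_mk]
  split_ifs with h
  · simp [denumerant_cons_of_le l ha h]
  · simp [denumerant_cons_of_lt l (not_le.1 h)]

theorem denumerantSeries_mul_prod {l : List ℕ} (hl : ∀ a ∈ l, 0 < a) :
    denumerantSeries l * (l.map fun a => 1 - (X : ℤ⟦X⟧) ^ a).prod = 1 := by
  induction l with
  | nil => simp [denumerantSeries_nil]
  | cons a l ih =>
    rw [List.map_cons, List.prod_cons, ← mul_assoc, mul_comm _ (1 - _),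
      one_sub_X_pow_mul_denumerantSeries (hl a (by simp)), ih fun b hb => hl b (by simp [hb])]

theorem exists_polynomial_eq_mul_denumerantSeries {M : ℕ} (hM : 0 < M) {l : List ℕ}
    (hl : ∀ a ∈ l, 0 < a ∧ a ∣ M) :
    ∃ P : Polynomial ℤ, P.natDegree + l.sum ≤ l.length * M ∧
      (P : ℤ⟦X⟧) = (1 - X ^ M) ^ l.length * denumerantSeries l := by
  induction l with
  | nil => exact ⟨1, by simp, by simp [denumerantSeries_nil]⟩
  | cons a l ih =>
    obtain ⟨P, hP, hPl⟩ := ih fun b hb => hl b (by simp [hb])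
    obtain ⟨ha, m, rfl⟩ := hl a (by simp)
    have hm : 0 < m := Nat.pos_of_mul_pos_left hM
    let Q : Polynomial ℤ := ∑ i ∈ range m, (Polynomial.X ^ a) ^ i
    have hQ : Q.natDegree ≤ a * (m - 1) := by
      refine Polynomial.natDegree_sum_le_of_forall_le _ _ fun i hi => ?_
      rw [← pow_mul, Polynomial.natDegree_X_pow]
      exact Nat.mul_le_mul_left _ (by have := mem_range.1 hi; omega)
    refine ⟨Q * P, ?_, ?_⟩
    · have h₁ := Polynomial.natDegree_mul_le (p := Q) (q := P)
      have h₂ : a * (m - 1) + a = a * m := by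
        rw [← Nat.mul_succ, Nat.succ_eq_add_one, Nat.sub_add_cancel hm]
      rw [List.sum_cons, List.length_cons, add_mul, one_mul]
      omega
    · have hgeom : (1 - X ^ (a * m) : ℤ⟦X⟧) = (1 - X ^ a) * (Q : ℤ⟦X⟧) := by
        rw [pow_mul, ← mul_neg_geom_sum]
        simp only [Q, ← Polynomial.coeToPowerSeries.ringHom_apply, map_sum, map_pow]
        simp
      rw [Polynomial.coe_mul, hPl, List.length_cons, pow_succ,
        ← one_sub_X_pow_mul_denumerantSeries ha l]
      nth_rewrite 3 [hgeom]
      ring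

end GeneratingFunction

section QuasiPolynomial

/-- Six times the value at `t` of the polynomial of degree at most three that takes the values
`v₀`, `v₁`, `v₂`, `v₃` at `0`, `1`, `2`, `3`. -/
def sixCubic (v₀ v₁ v₂ v₃ t : ℤ) : ℤ :=
  v₃ * (t * (t - 1) * (t - 2)) - 3 * v₂ * (t * (t - 1) * (t - 3)) +
    3 * v₁ * (t * (t - 2) * (t - 3)) - v₀ * ((t - 1) * (t - 2) * (t - 3))

theorem six_mul_eq_sixCubic {f : ℕ → ℤ}
    (hf : ∀ n, f (n + 4) = 4 * f (n + 3) - 6 * f (n + 2) + 4 * f (n + 1) - f n) (n : ℕ) :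
    6 * f n = sixCubic (f 0) (f 1) (f 2) (f 3) n := by
  suffices h : ∀ n : ℕ, 6 * f n = sixCubic (f 0) (f 1) (f 2) (f 3) n ∧
      6 * f (n + 1) = sixCubic (f 0) (f 1) (f 2) (f 3) (n + 1 : ℕ) ∧
      6 * f (n + 2) = sixCubic (f 0) (f 1) (f 2) (f 3) (n + 2 : ℕ) ∧
      6 * f (n + 3) = sixCubic (f 0) (f 1) (f 2) (f 3) (n + 3 : ℕ) from (h n).1
  intro n
  induction n with
  | zero =>
    simp only [sixCubic]
    push_cast
    refine ⟨?_, ?_, ?_, ?_⟩ <;> ring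
  | succ n ih =>
    obtain ⟨h₀, h₁, h₂, h₃⟩ := ih
    refine ⟨h₁, h₂, h₃, ?_⟩
    rw [show n + 1 + 3 = n + 4 from rfl, hf]
    simp only [sixCubic] at *
    push_cast at *
    linear_combination 4 * h₃ - 6 * h₂ + 4 * h₁ - h₀

theorem denumerant_add_mul_recurrence {M : ℕ} (hM : 0 < M) {l : List ℕ} (hlen : l.length = 4)
    (hl : ∀ a ∈ l, 0 < a ∧ a ∣ M) (r n : ℕ) :
    (denumerant l (r + M * (n + 4)) : ℤ) =
      4 * denumerant l (r + M * (n + 3)) - 6 * denumerant l (r + M * (n + 2)) +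
        4 * denumerant l (r + M * (n + 1)) - denumerant l (r + M * n) := by
  obtain ⟨P, hdeg, hP⟩ := exists_polynomial_eq_mul_denumerantSeries hM hl
  have hsum : 0 < l.sum := by
    obtain ⟨a, t, rfl⟩ := List.exists_cons_of_length_eq_add_one hlen
    have := (hl a (by simp)).1
    rw [List.sum_cons]
    omega
  rw [hlen] at hdeg hP
  have hzero : coeff (r + M * (n + 4)) (P : ℤ⟦X⟧) = 0 := by
    rw [Polynomial.coeff_coe]
    refine Polynomial.coeff_eq_zero_of_natDegree_lt ?_
    nlinarith
  have hexp : (1 - (X : ℤ⟦X⟧) ^ M) ^ 4 * denumerantSeries l =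
      denumerantSeries l - (X ^ M * denumerantSeries l + X ^ M * denumerantSeries l +
        X ^ M * denumerantSeries l + X ^ M * denumerantSeries l) +
      (X ^ (2 * M) * denumerantSeries l + X ^ (2 * M) * denumerantSeries l +
        X ^ (2 * M) * denumerantSeries l + X ^ (2 * M) * denumerantSeries l +
        X ^ (2 * M) * denumerantSeries l + X ^ (2 * M) * denumerantSeries l) -
      (X ^ (3 * M) * denumerantSeries l + X ^ (3 * M) * denumerantSeries l +
        X ^ (3 * M) * denumerantSeries l + X ^ (3 * M) * denumerantSeries l) +
      X ^ (4 * M) * denumerantSeries l := by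
    ring
  rw [hP, hexp] at hzero
  have hshift : ∀ i k : ℕ, i + k = 4 →
      coeff (r + M * (n + 4)) ((X : ℤ⟦X⟧) ^ (i * M) * denumerantSeries l) =
        denumerant l (r + M * (n + k)) := by
    intro i k hik
    have h : r + M * (n + 4) = i * M + (r + M * (n + k)) := by
      rw [← hik]
      ring
    rw [coeff_X_pow_mul_denumerantSeries (by omega), h, Nat.add_sub_cancel_left]
  have h₀ := hshift 0 4 rfl
  have h₁ := hshift 1 3 rfl
  have h₂ := hshift 2 2 rfl
  have h₃ := hshift 3 1 rfl
  have h₄ := hshift 4 0 rfl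
  simp only [zero_mul, pow_zero, one_mul, add_zero] at h₀ h₁ h₄
  simp only [map_add, map_sub, h₀, h₁, h₂, h₃, h₄] at hzero
  linarith

end QuasiPolynomial

section Tables

/-- The `n`-th digit of `T` in base `2 ^ 32`. -/
def digit (T n : ℕ) : ℕ := T / 2 ^ (32 * n) % 2 ^ 32

/-- A number whose first `K` digits in base `2 ^ 32` are meant to be the denumerants of `l`
at `0, …, K - 1`; see `checkTable`. -/
def table (K : ℕ) : List ℕ → ℕ
  | [] => 1
  | a :: l => table K l * ((2 ^ (32 * a * (K / a + 1)) - 1) / (2 ^ (32 * a) - 1)) % 2 ^ (32 * K)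

/-- Whether the digits of `T'` below position `K` arise from those of `T` as the denumerants of
`a :: l` arise from those of `l`. -/
def checkStep (a T T' : ℕ) : ℕ → Bool
  | 0 => true
  | n + 1 =>
    (digit T' n).beq (digit T n + bif a.ble n then digit T' (n - a) else 0) && checkStep a T T' n

/-- Whether the digits of `table K l` satisfy the recurrence of the denumerants of `l`. -/
def checkTable (K : ℕ) : List ℕ → Bool
  | [] => true
  | a :: l => checkStep a (table K l) (table K (a :: l)) K && checkTable K l

theorem digit_eq_of_checkStep {a T T' K : ℕ} (h : checkStep a T T' K = true) {n : ℕ}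
    (hn : n < K) : digit T' n = digit T n + if a ≤ n then digit T' (n - a) else 0 := by
  induction K with
  | zero => omega
  | succ K ih =>
    rw [checkStep, Bool.and_eq_true] at h
    rcases Nat.lt_succ_iff_lt_or_eq.1 hn with hn | rfl
    · exact ih h.2 hn
    · have := Nat.eq_of_beq_eq_true h.1
      rw [this]
      by_cases hle : a ≤ n
      · simp [hle, Nat.ble_eq_true_of_le hle]
      · simp [hle, Bool.eq_false_iff.2 (mt Nat.le_of_ble_eq_true hle)]

theorem denumerant_eq_digit {K : ℕ} {l : List ℕ} (hl : ∀ a ∈ l, 0 < a)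
    (h : checkTable K l = true) {n : ℕ} (hn : n < K) :
    denumerant l n = digit (table K l) n := by
  induction l generalizing n with
  | nil =>
    rcases Nat.eq_zero_or_pos n with rfl | hpos
    · simp [denumerant, digit, table]
    · have : 1 < 2 ^ (32 * n) := Nat.one_lt_two_pow (by omega)
      simp [denumerant, digit, table, hpos.ne', Nat.div_eq_of_lt this]
  | cons a l ih =>
    rw [checkTable, Bool.and_eq_true] at h
    have ha := hl a (by simp)
    induction n using Nat.strong_induction_on with
    | _ n ihn =>
      rw [digit_eq_of_checkStep h.1 hn, ← ih (fun b hb => hl b (by simp [hb])) h.2 hn]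
      split_ifs with hle
      · rw [denumerant_cons_of_le l ha hle, ihn _ (by omega) (by omega)]
      · rw [denumerant_cons_of_lt l (not_le.1 hle), add_zero]

end Tables

section Evaluation

/-- Six times the value at `j` of a quasi-polynomial of degree three and period `M`, read off
from its values at `0, …, 4 * M - 1`, which are the digits of `T`. -/
def sixQuasi (T M j : ℕ) : ℤ :=
  sixCubic (digit T (j % M)) (digit T (j % M + M)) (digit T (j % M + M * 2))
    (digit T (j % M + M * 3)) (j / M : ℕ)

/-- Sum of the values of `sixQuasi T M` at the first `k` terms of the progression
`j, j - a, j - 2 * a, …`. -/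
def sumSixQuasi (T M a j : ℕ) : ℕ → ℤ
  | 0 => 0
  | k + 1 => sumSixQuasi T M a j k + sixQuasi T M (j - a * k)

theorem sumSixQuasi_eq (T M a j k : ℕ) :
    sumSixQuasi T M a j k = ∑ i ∈ range k, sixQuasi T M (j - a * i) := by
  induction k with
  | zero => rfl
  | succ k ih => rw [sumSixQuasi, sum_range_succ, ih]

theorem six_mul_denumerant {M : ℕ} (hM : 0 < M) {l : List ℕ} (hlen : l.length = 4)
    (hl : ∀ a ∈ l, 0 < a ∧ a ∣ M) (h : checkTable (4 * M) l = true) (j : ℕ) :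
    6 * (denumerant l j : ℤ) = sixQuasi (table (4 * M) l) M j := by
  have hr := Nat.mod_lt j hM
  have hd : ∀ i < 4, denumerant l (j % M + M * i) = digit (table (4 * M) l) (j % M + M * i) :=
    fun i hi => denumerant_eq_digit (fun a ha => (hl a ha).1) h (by nlinarith)
  have := six_mul_eq_sixCubic (f := fun n => (denumerant l (j % M + M * n) : ℤ))
    (denumerant_add_mul_recurrence hM hlen hl (j % M)) (j / M)
  rw [Nat.mod_add_div] at this
  rw [this, sixQuasi, hd 0 (by omega), hd 1 (by omega), hd 2 (by omega), hd 3 (by omega)]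
  simp only [mul_zero, add_zero, mul_one]

theorem denumerant_cons_eq {M : ℕ} (hM : 0 < M) {l : List ℕ} (hlen : l.length = 4)
    (hl : ∀ a ∈ l, 0 < a ∧ a ∣ M) (h : checkTable (4 * M) l = true) {a j v : ℕ}
    (hv : sumSixQuasi (table (4 * M) l) M a j (j / a + 1) = (6 * v : ℕ)) :
    denumerant (a :: l) j = v := by
  rw [sumSixQuasi_eq] at hv
  have : (6 * denumerant (a :: l) j : ℤ) = (6 * v : ℕ) := by
    rw [← hv, denumerant_cons, Nat.cast_sum, mul_sum]
    exact sum_congr rfl fun i _ => six_mul_denumerant hM hlen hl h _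
  push_cast at this
  exact_mod_cast mul_left_cancel₀ (by norm_num) this

end Evaluation

section PartialFractions

/-- The partial fraction decomposition, in the variable `a`, of the generating function of a
knapsack whose five weights satisfy the relations `he`, `hg`, `hc`. -/
theorem knapsack_partial_fraction_field {K : Type*} [Field K] {a b c e g f t₁ t₂ t₃ t₄ : K}
    (he : a * b ^ 4 = e) (hg : g * a = b ^ 8) (hc : c * a ^ 2 = b ^ 5)
    (ha0 : a ≠ 0)
    (hf : f * ((1 - a) * (1 - b) * (1 - c) * (1 - e) * (1 - g)) = 1)
    (h₁ : t₁ * ((1 - a) * (1 - b) * (1 - b ^ 4) * (1 - b ^ 5) * (1 - b ^ 8)) = 1)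
    (h₂ : t₂ * ((1 - e) * (1 - b) * (1 - b ^ 4) * (1 - b ^ 12) * (1 - b ^ 13)) = 1)
    (h₃ : t₃ * ((1 - g) * (1 - b) * (1 - b ^ 8) * (1 - b ^ 11) * (1 - b ^ 12)) = 1)
    (h₄ : t₄ * ((1 - c) * (1 - b) * (1 - b ^ 5) * (1 - b ^ 11) * (1 - b ^ 13)) = 1) :
    f + b ^ 4 * e * t₂ + b ^ 11 * t₃ = a * t₁ +
      (c * a * (1 + b ^ 3 + b ^ 4 + b ^ 12) + (1 + b ^ 8 + b ^ 9 + b ^ 12)) * t₄ := by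
  have hg : g = b ^ 8 / a := by
    rw [← hg]
    field_simp
  have hc : c = b ^ 5 / a ^ 2 := by
    rw [← hc]
    field_simp
  have n := right_ne_zero_of_mul_eq_one hf
  have n₁ := right_ne_zero_of_mul_eq_one h₁
  have n₂ := right_ne_zero_of_mul_eq_one h₂
  have n₃ := right_ne_zero_of_mul_eq_one h₃
  have n₄ := right_ne_zero_of_mul_eq_one h₄
  rw [eq_one_div_of_mul_eq_one_left hf, eq_one_div_of_mul_eq_one_left h₁,
    eq_one_div_of_mul_eq_one_left h₂, eq_one_div_of_mul_eq_one_left h₃,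
    eq_one_div_of_mul_eq_one_left h₄]
  simp only [mul_ne_zero_iff] at n n₁ n₂ n₃ n₄
  obtain ⟨⟨⟨⟨na, nb⟩, nc⟩, ne⟩, ng⟩ := n
  obtain ⟨⟨⟨⟨-, -⟩, n4⟩, n5⟩, n8⟩ := n₁
  obtain ⟨⟨⟨⟨-, -⟩, -⟩, n12⟩, n13⟩ := n₂
  obtain ⟨⟨⟨⟨-, -⟩, -⟩, n11⟩, -⟩ := n₃
  rw [← he] at ne ⊢
  have ng' : a - b ^ 8 ≠ 0 := by
    intro h
    apply ng
    rw [hg, (div_eq_one_iff_eq ha0).2 (sub_eq_zero.1 h).symm, sub_self]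
  have nc' : a ^ 2 - b ^ 5 ≠ 0 := by
    intro h
    apply nc
    rw [hc, (div_eq_one_iff_eq (pow_ne_zero 2 ha0)).2 (sub_eq_zero.1 h).symm, sub_self]
  have hg1 : 1 - g = (a - b ^ 8) / a := by
    rw [hg]
    field_simp
  have hc1 : 1 - c = (a ^ 2 - b ^ 5) / a ^ 2 := by
    rw [hc]
    field_simp
  rw [hg1, hc1, hc]
  field_simp
  ring

theorem knapsack_partial_fraction {R : Type*} [CommRing R] [IsDomain R]
    {a b c e g f t₁ t₂ t₃ t₄ : R}
    (he : a * b ^ 4 = e) (hg : g * a = b ^ 8) (hc : c * a ^ 2 = b ^ 5) (ha0 : a ≠ 0)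
    (hf : f * ((1 - a) * (1 - b) * (1 - c) * (1 - e) * (1 - g)) = 1)
    (h₁ : t₁ * ((1 - a) * (1 - b) * (1 - b ^ 4) * (1 - b ^ 5) * (1 - b ^ 8)) = 1)
    (h₂ : t₂ * ((1 - e) * (1 - b) * (1 - b ^ 4) * (1 - b ^ 12) * (1 - b ^ 13)) = 1)
    (h₃ : t₃ * ((1 - g) * (1 - b) * (1 - b ^ 8) * (1 - b ^ 11) * (1 - b ^ 12)) = 1)
    (h₄ : t₄ * ((1 - c) * (1 - b) * (1 - b ^ 5) * (1 - b ^ 11) * (1 - b ^ 13)) = 1) :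
    f + b ^ 4 * e * t₂ + b ^ 11 * t₃ = a * t₁ +
      (c * a * (1 + b ^ 3 + b ^ 4 + b ^ 12) + (1 + b ^ 8 + b ^ 9 + b ^ 12)) * t₄ := by
  let φ := algebraMap R (FractionRing R)
  have hφ : Function.Injective φ := IsFractionRing.injective R (FractionRing R)
  apply hφ
  have := knapsack_partial_fraction_field (a := φ a) (b := φ b) (c := φ c) (e := φ e) (g := φ g)
    (f := φ f) (t₁ := φ t₁) (t₂ := φ t₂) (t₃ := φ t₃) (t₄ := φ t₄)
    (by simpa using congrArg φ he) (by simpa using congrArg φ hg) (by simpa using congrArg φ hc)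
    ((map_ne_zero_iff φ hφ).2 ha0) (by simpa using congrArg φ hf) (by simpa using congrArg φ h₁)
    (by simpa using congrArg φ h₂) (by simpa using congrArg φ h₃) (by simpa using congrArg φ h₄)
  simpa using this

end PartialFractions

theorem denumerant_knapsack (n : ℕ) (hn : 1000000 ≤ n) (hodd : n % 2 = 1) :
    (denumerant [12223, 12224, 36674, 61119, 85569] n : ℤ) +
        denumerant (61119 :: [1, 4, 12, 13].map (12224 * ·)) (n - 110015) +
        denumerant (85569 :: [1, 8, 11, 12].map (12224 * ·)) (n - 134464) =
      denumerant (12223 :: [1, 4, 5, 8].map (12224 * ·)) (n - 12223) +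
        (denumerant (36674 :: [1, 5, 11, 13].map (12224 * ·)) (n - 48897) +
        denumerant (36674 :: [1, 5, 11, 13].map (12224 * ·)) (n - 85569) +
        denumerant (36674 :: [1, 5, 11, 13].map (12224 * ·)) (n - 97793) +
        denumerant (36674 :: [1, 5, 11, 13].map (12224 * ·)) (n - 195585)) := by
  have hpos : ∀ {a : ℕ} {l : List ℕ}, 0 < a → (∀ b ∈ l, 0 < b) →
      ∀ b ∈ a :: l.map (12224 * ·), 0 < b := by
    intro a l ha hl b hb
    simp only [List.mem_cons, List.mem_map] at hb
    rcases hb with rfl | ⟨c, hc, rfl⟩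
    · exact ha
    · exact Nat.mul_pos (by norm_num) (hl c hc)
  have hser := knapsack_partial_fraction (R := ℤ⟦X⟧)
    (a := X ^ 12223) (b := X ^ 12224) (c := X ^ 36674) (e := X ^ 61119) (g := X ^ 85569)
    (f := denumerantSeries [12223, 12224, 36674, 61119, 85569])
    (t₁ := denumerantSeries (12223 :: [1, 4, 5, 8].map (12224 * ·)))
    (t₂ := denumerantSeries (61119 :: [1, 4, 12, 13].map (12224 * ·)))
    (t₃ := denumerantSeries (85569 :: [1, 8, 11, 12].map (12224 * ·)))
    (t₄ := denumerantSeries (36674 :: [1, 5, 11, 13].map (12224 * ·)))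
    (by rw [← pow_mul, ← pow_add]) (by rw [← pow_mul, ← pow_add])
    (by rw [← pow_mul, ← pow_mul, ← pow_add]) (pow_ne_zero _ X_ne_zero)
    (by
      simpa [mul_assoc] using denumerantSeries_mul_prod
        (l := [12223, 12224, 36674, 61119, 85569]) (by simp))
    (by
      simpa [mul_assoc, ← pow_mul] using denumerantSeries_mul_prod
        (hpos (a := 12223) (l := [1, 4, 5, 8]) (by norm_num) (by simp)))
    (by
      simpa [mul_assoc, ← pow_mul] using denumerantSeries_mul_prod
        (hpos (a := 61119) (l := [1, 4, 12, 13]) (by norm_num) (by simp)))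
    (by
      simpa [mul_assoc, ← pow_mul] using denumerantSeries_mul_prod
        (hpos (a := 85569) (l := [1, 8, 11, 12]) (by norm_num) (by simp)))
    (by
      simpa [mul_assoc, ← pow_mul] using denumerantSeries_mul_prod
        (hpos (a := 36674) (l := [1, 5, 11, 13]) (by norm_num) (by simp)))
  have heven : ∀ m, m % 2 = 1 → denumerant (36674 :: [1, 5, 11, 13].map (12224 * ·)) m = 0 := by
    intro m hm
    have h := denumerant_map_mul two_pos (18337 :: [1, 5, 11, 13].map (6112 * ·)) m
    rw [if_neg (by omega)] at h
    simpa using h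
  simp only [mul_add, add_mul, mul_one, one_mul, ← pow_mul, ← pow_add] at hser
  have hcoeff := congrArg (coeff n) hser
  have h0 : coeff n (denumerantSeries (36674 :: [1, 5, 11, 13].map (12224 * ·))) = 0 := by
    simp only [denumerantSeries, coeff_mk, heven n hodd, Nat.cast_zero]
  have hf : coeff n (denumerantSeries [12223, 12224, 36674, 61119, 85569]) =
      denumerant [12223, 12224, 36674, 61119, 85569] n := by
    simp only [denumerantSeries, coeff_mk]
  simp only [map_add] at hcoeff
  rw [hf, h0] at hcoeff
  iterate 10 rw [coeff_X_pow_mul_denumerantSeries (by omega)] at hcoeff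
  rw [heven (n - 12224 * 8) (by omega), heven (n - 12224 * 9) (by omega),
    heven (n - 12224 * 12) (by omega)] at hcoeff
  simp only [Nat.cast_zero, add_zero, Nat.reduceMul, Nat.reduceAdd] at hcoeff
  exact hcoeff

theorem checkTable_1_4_5_8 : checkTable (4 * 40) [1, 4, 5, 8] = true := by
  decide +kernel

theorem checkTable_1_4_12_13 : checkTable (4 * 156) [1, 4, 12, 13] = true := by
  decide +kernel

theorem checkTable_1_8_11_12 : checkTable (4 * 264) [1, 8, 11, 12] = true := by
  decide +kernel

theorem checkTable_1_5_11_13 : checkTable (4 * 715) [1, 5, 11, 13] = true := by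
  decide +kernel

/-- Section 5.1: the number of natural-number solutions of the Aardal–Lenstra
knapsack equation with right-hand side `89643481 × 1001` is `94267024658624993843`. -/
theorem stmt_12 :
    {x : ℕ × ℕ × ℕ × ℕ × ℕ |
        12223 * x.1 + 12224 * x.2.1 + 36674 * x.2.2.1 + 61119 * x.2.2.2.1
          + 85569 * x.2.2.2.2 = 89643481 * 1001}.ncard
      = 94267024658624993843 := by
  have hcount := (finite_ncard_prod (a := 12223) (by norm_num)
    (finite_ncard_prod (a := 12224) (by norm_num)
    (finite_ncard_prod (a := 36674) (by norm_num)
    (finite_ncard_prod (a := 61119) (by norm_num)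
    (finite_ncard_linear 85569 (by norm_num))))) (89643481 * 1001)).2
  simp only [← add_assoc] at hcount
  rw [hcount]
  have hC : ∀ j m v : ℕ, m = 2 * (18337 * 2144 + 6112 * j) →
      sumSixQuasi (table (4 * 715) [1, 5, 11, 13]) 715 18337 j (j / 18337 + 1) = (6 * v : ℕ) →
      denumerant (36674 :: [1, 5, 11, 13].map (12224 * ·)) m = v := by
    rintro j m v rfl hv
    have h := denumerant_map_mul two_pos (18337 :: [1, 5, 11, 13].map (6112 * ·))
      (2 * (18337 * 2144 + 6112 * j))
    rw [if_pos (dvd_mul_right _ _), Nat.mul_div_cancel_left _ two_pos,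
      denumerant_cons_map_mul (by norm_num) (by norm_num) (by norm_num),
      denumerant_cons_eq (by norm_num) rfl (by decide) checkTable_1_5_11_13 hv] at h
    simpa using h
  have h0 : denumerant (12223 :: [1, 4, 5, 8].map (12224 * ·)) (89643481 * 1001 - 12223) =
      61804323556371339555 := by
    rw [show 89643481 * 1001 - 12223 = 12223 * 7934 + 12224 * 7332799 by norm_num,
      denumerant_cons_map_mul (by norm_num) (by norm_num) (by norm_num)]
    exact denumerant_cons_eq (by norm_num) rfl (by decide) checkTable_1_4_5_8
      (by decide +kernel)
  have h1 : denumerant (61119 :: [1, 4, 12, 13].map (12224 * ·)) (89643481 * 1001 - 110015) =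
      3156566025769780361 := by
    rw [show 89643481 * 1001 - 110015 = 61119 * 7934 + 12224 * 7301055 by norm_num,
      denumerant_cons_map_mul (by norm_num) (by norm_num) (by norm_num)]
    exact denumerant_cons_eq (by norm_num) rfl (by decide) checkTable_1_4_12_13
      (by decide +kernel)
  have h2 : denumerant (85569 :: [1, 8, 11, 12].map (12224 * ·)) (89643481 * 1001 - 134464) =
      1348202871712138132 := by
    rw [show 89643481 * 1001 - 134464 = 85569 * 4289 + 12224 * 7310699 by norm_num,
      denumerant_cons_map_mul (by norm_num) (by norm_num) (by norm_num)]
    exact denumerant_cons_eq (by norm_num) rfl (by decide) checkTable_1_8_11_12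
      (by decide +kernel)
  have h3 : denumerant (36674 :: [1, 5, 11, 13].map (12224 * ·)) (89643481 * 1001 - 48897) =
      9241891411741317897 := by
    exact hC 7334297 _ _ (by norm_num) (by decide +kernel)
  have h4 : denumerant (36674 :: [1, 5, 11, 13].map (12224 * ·)) (89643481 * 1001 - 85569) =
      9241876309528970838 := by
    exact hC 7334294 _ _ (by norm_num) (by decide +kernel)
  have h5 : denumerant (36674 :: [1, 5, 11, 13].map (12224 * ·)) (89643481 * 1001 - 97793) =
      9241871275462301386 := by
    exact hC 7334293 _ _ (by norm_num) (by decide +kernel)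
  have h6 : denumerant (36674 :: [1, 5, 11, 13].map (12224 * ·)) (89643481 * 1001 - 195585) =
      9241831003002982660 := by
    exact hC 7334285 _ _ (by norm_num) (by decide +kernel)
  have hsum := denumerant_knapsack (89643481 * 1001) (by norm_num) (by norm_num)
  rw [h0, h1, h2, h3, h4, h5, h6] at hsum
  push_cast at hsum
  have : (denumerant [12223, 12224, 36674, 61119, 85569] (89643481 * 1001) : ℤ) =
      (94267024658624993843 : ℕ) := by
    push_cast
    linarith
  exact_mod_cast this
end

section
/- The number of 6 × 6 matrices M with natural number entries such that every row sum of M equals 1, every column sum of M equals 1, the main diagonal sum Σ_{i} M_{i,i} equals 1, and the antidiagonal sum Σ_{i} M_{i,7−i} equals 1, is exactly 96. -/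
/-- A natural number matrix whose row and column sums all equal one is a permutation matrix. -/
theorem exists_perm_of_row_col_sums_eq_one {ι : Type*} [Fintype ι] [DecidableEq ι]
    {M : ι → ι → ℕ} (hrow : ∀ i, ∑ j, M i j = 1) (hcol : ∀ j, ∑ i, M i j = 1) :
    ∃ σ : Equiv.Perm ι, M = fun i j => if σ i = j then 1 else 0 := by
  have hex : ∀ i, ∃ j, M i j ≠ 0 := fun i => by
    by_contra! h
    simpa [h] using hrow i
  choose f hf using hex
  have hle : ∀ i j, M i j ≤ 1 := fun i j =>
    (Finset.single_le_sum (fun k _ => Nat.zero_le (M i k)) (Finset.mem_univ j)).trans_eq (hrow i)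
  have hone : ∀ i, M i (f i) = 1 := fun i => le_antisymm (hle i _) (Nat.one_le_iff_ne_zero.2 (hf i))
  have hzero : ∀ i j, f i ≠ j → M i j = 0 := fun i j hij => by
    have h := Finset.add_le_sum (f := M i) (fun k _ => Nat.zero_le _)
      (Finset.mem_univ (f i)) (Finset.mem_univ j) hij
    have := hrow i
    have := hone i
    omega
  have hinj : Function.Injective f := fun a b hab => by
    by_contra hne
    have h := Finset.add_le_sum (f := fun i => M i (f a)) (fun k _ => Nat.zero_le _)
      (Finset.mem_univ a) (Finset.mem_univ b) hne
    have hb : M b (f a) = 1 := hab ▸ hone b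
    have := hcol (f a)
    have := hone a
    omega
  refine ⟨Equiv.ofBijective f hinj.bijective_of_finite, ?_⟩
  funext i j
  rw [Equiv.ofBijective_apply]
  split_ifs with h
  · exact h ▸ hone i
  · exact hzero i j h

/-- There are 96 permutations of six points whose permutation matrix has exactly one entry on the
main diagonal and exactly one on the antidiagonal. -/
theorem card_perm_fin_six_diagonal_antidiagonal :
    (Finset.univ.filter fun σ : Equiv.Perm (Fin 6) =>
      (∑ i, if σ i = i then 1 else 0) = 1 ∧ (∑ i, if σ i = i.rev then 1 else 0) = 1).card = 96 := by
  decide +kernel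

/-- Section 5.2: the number of 6 × 6 magic squares with natural number entries
and magic sum 1 (all row sums, column sums, the main diagonal sum and the
antidiagonal sum equal to 1) is 96. -/
theorem stmt_13 :
    {M : Fin 6 → Fin 6 → ℕ |
        (∀ i, ∑ j, M i j = 1) ∧ (∀ j, ∑ i, M i j = 1) ∧
        (∑ i, M i i = 1) ∧ (∑ i, M i i.rev = 1)}.ncard = 96 := by
  let P : Equiv.Perm (Fin 6) → Fin 6 → Fin 6 → ℕ := fun σ i j => if σ i = j then 1 else 0
  have hP : Function.Injective P := fun σ τ h => by
    ext1 i
    have := congrFun (congrFun h i) (σ i)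
    by_contra hne
    simp [P, Ne.symm hne] at this
  rw [← card_perm_fin_six_diagonal_antidiagonal, ← Set.ncard_coe_finset,
    ← Set.ncard_image_of_injective _ hP]
  congr 1
  ext M
  simp only [Set.mem_ofPred_eq, Set.mem_image, Finset.coe_filter, Finset.mem_univ, true_and]
  constructor
  · rintro ⟨hrow, hcol, hdiag, hanti⟩
    obtain ⟨σ, rfl⟩ := exists_perm_of_row_col_sums_eq_one hrow hcol
    exact ⟨σ, ⟨hdiag, hanti⟩, rfl⟩
  · rintro ⟨σ, ⟨hdiag, hanti⟩, rfl⟩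
    refine ⟨fun i => by simp [P], fun j => ?_, hdiag, hanti⟩
    simp [P, ← Equiv.eq_symm_apply]
end

section
/- The number of 6 × 6 matrices M with natural number entries such that every row sum of M equals 2, every column sum of M equals 2, the main diagonal sum Σ_{i} M_{i,i} equals 2, and the antidiagonal sum Σ_{i} M_{i,7−i} equals 2, is exactly 14763. -/
/-- Apply `f` to `n`, evaluating `n` to a numeral first when the kernel reduces the term. -/
def strict {α : Type*} (n : ℕ) (f : ℕ → α) : α :=
  Nat.casesOn n (f 0) fun k => f (k + 1)

theorem strict_eq {α : Type*} (n : ℕ) (f : ℕ → α) : strict n f = f n := by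
  cases n <;> rfl

/-- The list `l` with all entries evaluated to numerals, passed to `f`. -/
def strictList {α : Type*} : List ℕ → (List ℕ → α) → α
  | [], f => f []
  | a :: l, f => strict a fun a' => strictList l fun l' => f (a' :: l')

theorem strictList_eq {α : Type*} (l : List ℕ) (f : List ℕ → α) : strictList l f = f l := by
  induction l generalizing f with
  | nil => rfl
  | cons a l ih => simp [strictList, strict_eq, ih]

/-- `t` has at most `n` hexadecimal digits, all of them at most `b`. -/
def digitsLE (b : ℕ) : ℕ → ℕ → Bool
  | 0, t => Nat.beq t 0
  | n + 1, t => Nat.ble (t % 16) b && digitsLE b n (t / 16)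

theorem digitsLE_mono {b c n t : ℕ} (hbc : b ≤ c) (h : digitsLE b n t = true) :
    digitsLE c n t = true := by
  induction n generalizing t with
  | zero => exact h
  | succ n ih =>
    simp only [digitsLE, Bool.and_eq_true, Nat.ble_eq] at h ⊢
    exact ⟨h.1.trans hbc, ih h.2⟩

theorem digitsLE_add {b c n t u : ℕ} (hbc : b + c < 16) (ht : digitsLE b n t = true)
    (hu : digitsLE c n u = true) : digitsLE (b + c) n (t + u) = true := by
  induction n generalizing t u with
  | zero => simp_all [digitsLE]
  | succ n ih =>
    simp only [digitsLE, Bool.and_eq_true, Nat.ble_eq] at ht hu ⊢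
    have hdiv : (t + u) / 16 = t / 16 + u / 16 := by omega
    exact ⟨by omega, hdiv ▸ ih ht.2 hu.2⟩

/-- The number of ways to write `t` as a sum of one entry from each of the given lists. -/
def numSums : List (List ℕ) → ℕ → ℕ
  | [], t => if t = 0 then 1 else 0
  | R :: Rs, t => (R.map fun r => if r ≤ t then numSums Rs (t - r) else 0).sum

theorem digitsLE_of_numSums_ne_zero {n : ℕ} {Rs : List (List ℕ)}
    (hRs : ∀ R ∈ Rs, ∀ r ∈ R, digitsLE 2 n r = true) (hlen : 2 * Rs.length < 16) {t : ℕ}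
    (ht : numSums Rs t ≠ 0) : digitsLE (2 * Rs.length) n t = true := by
  induction Rs generalizing t with
  | nil =>
    obtain rfl : t = 0 := by simpa [numSums] using ht
    clear ht
    induction n with
    | zero => rfl
    | succ n ih => simpa [digitsLE] using ih
  | cons R Rs ih =>
    simp only [List.length_cons] at hlen ⊢
    obtain ⟨r, hr, h⟩ : ∃ r ∈ R, (if r ≤ t then numSums Rs (t - r) else 0) ≠ 0 := by
      by_contra! hcon
      exact ht (List.sum_eq_zero (by simpa using hcon))
    have hrt : r ≤ t := by
      by_contra hcon
      exact h (if_neg hcon)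
    rw [if_pos hrt] at h
    have hrest := ih (fun R hR => hRs R (List.mem_cons_of_mem _ hR)) (by omega) h
    have hadd := digitsLE_add (by omega) (hRs R List.mem_cons_self r hr) hrest
    rwa [Nat.add_sub_cancel' hrt, add_comm, ← Nat.mul_succ] at hadd

/-- The sum of `g` over a list of keys with multiplicities. -/
def weight (s : List (ℕ × ℕ)) (g : ℕ → ℕ) : ℕ :=
  (s.map fun x => x.2 * g x.1).sum

theorem weight_singleton (k : ℕ) (g : ℕ → ℕ) : weight [(k, 1)] g = g k := by
  simp [weight]

/-- Merge two lists sorted by key, adding the multiplicities of equal keys; the first argument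
bounds the recursion depth. -/
def mergeKeys : ℕ → List (ℕ × ℕ) → List (ℕ × ℕ) → List (ℕ × ℕ)
  | 0, s, t => s ++ t
  | _ + 1, [], t => t
  | _ + 1, x :: s, [] => x :: s
  | n + 1, x :: s, y :: t =>
    bif Nat.blt x.1 y.1 then x :: mergeKeys n s (y :: t)
    else bif Nat.blt y.1 x.1 then y :: mergeKeys n (x :: s) t
    else strict (x.2 + y.2) fun m => (x.1, m) :: mergeKeys n s t

theorem weight_mergeKeys (n : ℕ) (s t : List (ℕ × ℕ)) (g : ℕ → ℕ) :
    weight (mergeKeys n s t) g = weight s g + weight t g := by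
  induction n generalizing s t with
  | zero => simp [mergeKeys, weight]
  | succ n ih =>
    match s, t with
    | [], t => simp [mergeKeys, weight]
    | x :: s, [] => simp [mergeKeys, weight]
    | x :: s, y :: t =>
      simp only [weight, List.map_cons, List.sum_cons] at ih ⊢
      simp only [mergeKeys, strict_eq]
      cases h₁ : Nat.blt x.1 y.1
      · cases h₂ : Nat.blt y.1 x.1
        · have hxy : x.1 = y.1 := by
            simp only [← Bool.not_eq_true, Nat.blt_eq] at h₁ h₂
            omega
          simp only [cond_false, List.map_cons, List.sum_cons, ih, hxy]
          ring
        · simp only [cond_false, cond_true, List.map_cons, List.sum_cons, ih]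
          ring
      · simp only [cond_true, List.map_cons, List.sum_cons, ih]
        ring

/-- Subtract `r` from all keys, discarding those that cannot be completed. -/
def shiftKeys (r : ℕ) : List (ℕ × ℕ) → List (ℕ × ℕ)
  | [] => []
  | x :: s =>
    bif Nat.ble r x.1 then
      strict (x.1 - r) fun k =>
        bif digitsLE 12 8 k then (k, x.2) :: shiftKeys r s else shiftKeys r s
    else shiftKeys r s

theorem weight_shiftKeys (r : ℕ) (s : List (ℕ × ℕ)) (g : ℕ → ℕ)
    (hg : ∀ t, g t ≠ 0 → digitsLE 12 8 t = true) :
    weight (shiftKeys r s) g = weight s fun t => if r ≤ t then g (t - r) else 0 := by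
  induction s with
  | nil => rfl
  | cons x s ih =>
    simp only [weight, List.map_cons, List.sum_cons] at ih ⊢
    simp only [shiftKeys, strict_eq]
    by_cases hr : r ≤ x.1
    · rw [Nat.ble_eq_true_of_le hr, cond_true, if_pos hr]
      cases hd : digitsLE 12 8 (x.1 - r)
      · have h0 : g (x.1 - r) = 0 := by
          by_contra h
          simp [hg _ h] at hd
        simpa [h0] using ih
      · simp [ih]
    · have hb : Nat.ble r x.1 = false := by
        simpa only [← Bool.not_eq_true, Nat.ble_eq] using hr
      simp [hb, hr, ih]

/-- Subtract the entries of `R` from all keys in all possible ways. -/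
def stepKeys (R : List ℕ) (s : List (ℕ × ℕ)) : List (ℕ × ℕ) :=
  R.foldr (fun r acc => mergeKeys 5000 (shiftKeys r s) acc) []

theorem weight_stepKeys (R : List ℕ) (s : List (ℕ × ℕ)) (g : ℕ → ℕ)
    (hg : ∀ t, g t ≠ 0 → digitsLE 12 8 t = true) :
    weight (stepKeys R s) g =
      weight s fun t => (R.map fun r => if r ≤ t then g (t - r) else 0).sum := by
  induction R with
  | nil => simp [stepKeys, weight]
  | cons r R ih =>
    rw [stepKeys, List.foldr_cons, weight_mergeKeys, weight_shiftKeys r s g hg]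
    rw [stepKeys] at ih
    rw [ih]
    simp only [weight, ← List.sum_map_add, List.map_cons, List.sum_cons, mul_add]

/-- Evaluate `numSums` one summand at a time, collecting equal remainders. -/
def runKeys : List (List ℕ) → List (ℕ × ℕ) → ℕ
  | [], s => weight s (numSums [])
  | R :: Rs, s => strictList R fun R' => runKeys Rs (stepKeys R' s)

theorem runKeys_eq {Rs : List (List ℕ)} (hRs : ∀ R ∈ Rs, ∀ r ∈ R, digitsLE 2 8 r = true)
    (hlen : Rs.length ≤ 6) (s : List (ℕ × ℕ)) : runKeys Rs s = weight s (numSums Rs) := by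
  induction Rs generalizing s with
  | nil => rfl
  | cons R Rs ih =>
    have hRs' : ∀ R ∈ Rs, ∀ r ∈ R, digitsLE 2 8 r = true :=
      fun R hR => hRs R (List.mem_cons_of_mem _ hR)
    rw [List.length_cons] at hlen
    rw [runKeys, strictList_eq, ih hRs' (by omega), weight_stepKeys]
    · rfl
    · exact fun t ht =>
        digitsLE_mono (by omega) (digitsLE_of_numSums_ne_zero hRs' (by omega) ht)

theorem sum_piFinset_eq_numSums {α : Type*} (R : Finset α) (L : List α)
    (hL : ∀ f : α → ℕ, ∑ x ∈ R, f x = (L.map f).sum) {n : ℕ} (c : Fin n → α → ℕ) (t : ℕ) :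
    (∑ p ∈ Fintype.piFinset fun _ : Fin n => R, if ∑ i, c i (p i) = t then 1 else 0) =
      numSums (List.ofFn fun i => L.map (c i)) t := by
  induction n generalizing t with
  | zero => simp [numSums, eq_comm]
  | succ n ih =>
    have hcons : (∑ p ∈ Fintype.piFinset fun _ : Fin (n + 1) => R,
          if ∑ i, c i (p i) = t then 1 else 0) =
        ∑ q ∈ R ×ˢ Fintype.piFinset fun _ : Fin n => R,
          if c 0 q.1 + ∑ i, c i.succ (q.2 i) = t then 1 else 0 := by
      refine Finset.sum_nbij' (fun p => (p 0, Fin.tail p)) (fun q => Fin.cons q.1 q.2)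
        ?_ ?_ ?_ ?_ ?_
      · simp +contextual [Fin.tail]
      · simp +contextual [Fin.forall_fin_succ]
      · simp
      · simp
      · exact fun p _ => by simp only [Fin.sum_univ_succ, Fin.tail]; rfl
    rw [hcons, Finset.sum_product, hL, List.ofFn_succ, numSums, List.map_map]
    congr 1
    refine List.map_congr_left fun x _ => ?_
    simp only [Function.comp_apply]
    split_ifs with hx
    · rw [← ih]
      refine Finset.sum_congr rfl fun p _ => ?_
      congr 1
      simp only [eq_iff_iff]
      omega
    · refine Finset.sum_eq_zero fun p _ => if_neg ?_
      omega

/-- The contribution of the `i`-th row `x` to the column sums, the diagonal sum and the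
antidiagonal sum, as the hexadecimal digits of a single number; the number with eight hexadecimal
digits `2` is `572662306`. -/
def rowCode (i : Fin 6) (x : Fin 6 → ℕ) : ℕ :=
  x 0 + 16 * x 1 + 16 ^ 2 * x 2 + 16 ^ 3 * x 3 + 16 ^ 4 * x 4 + 16 ^ 5 * x 5 +
    16 ^ 6 * x i + 16 ^ 7 * x i.rev

theorem sum_rowCode_eq_iff {M : Fin 6 → Fin 6 → ℕ} (hM : ∀ i, ∑ j, M i j = 2) :
    ∑ i, rowCode i (M i) = 572662306 ↔
      (∀ j, ∑ i, M i j = 2) ∧ (∑ i, M i i = 2) ∧ (∑ i, M i i.rev = 2) := by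
  have hle : ∀ i j, M i j ≤ 2 := fun i j =>
    hM i ▸ Finset.single_le_sum (f := M i) (fun _ _ => Nat.zero_le _) (Finset.mem_univ j)
  have hsum : ∀ f : Fin 6 → Fin 6, ∑ i, M i (f i) ≤ 12 := fun f =>
    (Finset.sum_le_sum fun i _ => hle i (f i)).trans (by simp)
  have hdigits : ∀ c₀ c₁ c₂ c₃ c₄ c₅ d a : ℕ, c₀ ≤ 12 → c₁ ≤ 12 → c₂ ≤ 12 → c₃ ≤ 12 →
      c₄ ≤ 12 → c₅ ≤ 12 → d ≤ 12 → a ≤ 12 →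
      (c₀ + 16 * c₁ + 16 ^ 2 * c₂ + 16 ^ 3 * c₃ + 16 ^ 4 * c₄ + 16 ^ 5 * c₅ + 16 ^ 6 * d +
        16 ^ 7 * a = 572662306 ↔
      (c₀ = 2 ∧ c₁ = 2 ∧ c₂ = 2 ∧ c₃ = 2 ∧ c₄ = 2 ∧ c₅ = 2) ∧ d = 2 ∧ a = 2) := by
    omega
  have hforall : ∀ P : Fin 6 → Prop, (∀ j, P j) ↔ P 0 ∧ P 1 ∧ P 2 ∧ P 3 ∧ P 4 ∧ P 5 := by
    simp [Fin.forall_fin_succ]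
  rw [hforall]
  simp only [rowCode, Finset.sum_add_distrib, ← Finset.mul_sum]
  exact hdigits _ _ _ _ _ _ _ _ (hsum _) (hsum _) (hsum _) (hsum _) (hsum _) (hsum _)
    (hsum id) (hsum Fin.rev)

theorem runKeys_rowCode :
    runKeys (List.ofFn fun i => (List.Nat.antidiagonalTuple 6 2).map (rowCode i))
      [(572662306, 1)] = 14763 := by
  decide +kernel

theorem digitsLE_rowCode :
    ∀ R ∈ List.ofFn fun i => (List.Nat.antidiagonalTuple 6 2).map (rowCode i),
      ∀ r ∈ R, digitsLE 2 8 r = true := by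
  decide +kernel

theorem numSums_rowCode :
    numSums (List.ofFn fun i => (List.Nat.antidiagonalTuple 6 2).map (rowCode i))
      572662306 = 14763 := by
  rw [← weight_singleton _ (numSums _), ← runKeys_eq digitsLE_rowCode (by rw [List.length_ofFn])]
  exact runKeys_rowCode

/-- Section 5.2: the number of 6 × 6 magic squares with natural number entries
and magic sum 2 (all row sums, column sums, the main diagonal sum and the
antidiagonal sum equal to 2) is 14763. -/
theorem stmt_14 :
    {M : Fin 6 → Fin 6 → ℕ |
        (∀ i, ∑ j, M i j = 2) ∧ (∀ j, ∑ i, M i j = 2) ∧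
        (∑ i, M i i = 2) ∧ (∑ i, M i i.rev = 2)}.ncard = 14763 := by
  have hset : {M : Fin 6 → Fin 6 → ℕ |
        (∀ i, ∑ j, M i j = 2) ∧ (∀ j, ∑ i, M i j = 2) ∧
        (∑ i, M i i = 2) ∧ (∑ i, M i i.rev = 2)} =
      ((Fintype.piFinset fun _ : Fin 6 => Finset.Nat.antidiagonalTuple 6 2).filter
        fun M => ∑ i, rowCode i (M i) = 572662306 : Finset (Fin 6 → Fin 6 → ℕ)) := by
    ext M
    simp only [Set.mem_ofPred_eq, Finset.coe_filter, Fintype.mem_piFinset,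
      Finset.Nat.mem_antidiagonalTuple]
    exact and_congr_right fun hM => (sum_rowCode_eq_iff hM).symm
  have hsum := sum_piFinset_eq_numSums (Finset.Nat.antidiagonalTuple 6 2)
    (List.Nat.antidiagonalTuple 6 2) (fun _ => rfl) rowCode 572662306
  rw [hset, Set.ncard_coe_finset, Finset.card_filter, hsum]
  exact numSums_rowCode
end

section
/- The number of 6 × 6 matrices M with natural number entries such that every row sum of M equals 3, every column sum of M equals 3, the main diagonal sum Σ_{i} M_{i,i} equals 3, and the antidiagonal sum Σ_{i} M_{i,7−i} equals 3, is exactly 957936. -/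
open Finset

namespace MagicSquare

/-- A row or a column of a `3 × 3` block. -/
abbrev Triple := ℕ × ℕ × ℕ

/-- A `3 × 3` block, as the triple of its rows. -/
abbrev Block := Triple × Triple × Triple

/-- The triples with entries at most `3`. -/
def box : Finset Triple := range 4 ×ˢ range 4 ×ˢ range 4

/-- The blocks with entries at most `3`. -/
def blocks : Finset Block := box ×ˢ box ×ˢ box

lemma blocks_eq : blocks = box ×ˢ box ×ˢ box := rfl

-- Otherwise elaboration tries to evaluate `A ∈ blocks`.
attribute [irreducible] blocks

def total (v : Triple) : ℕ := v.1 + v.2.1 + v.2.2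

/-- The complement of a triple with respect to the magic sum `3`. -/
def compl (v : Triple) : Triple := (3 - v.1, 3 - v.2.1, 3 - v.2.2)

def rowSums (A : Block) : Triple := (total A.1, total A.2.1, total A.2.2)

def colSums (A : Block) : Triple := A.1 + A.2.1 + A.2.2

def diag (A : Block) : ℕ := A.1.1 + A.2.1.2.1 + A.2.2.2.2

/-- The sum of `f` over the triples in `box` with total `k`, in a form suited to evaluation. -/
def boxSum (k : ℕ) (f : Triple → ℕ) : ℕ :=
  sum4 fun a ↦ sum4 fun b ↦ bif Nat.ble (a + b) k then pick (k - (a + b)) fun c ↦ f (a, b, c) else 0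
where
  sum4 (f : ℕ → ℕ) : ℕ := f 0 + f 1 + f 2 + f 3
  pick (n : ℕ) (f : ℕ → ℕ) : ℕ :=
    bif Nat.beq n 0 then f 0 else bif Nat.beq n 1 then f 1 else
    bif Nat.beq n 2 then f 2 else bif Nat.beq n 3 then f 3 else 0

def le (v c : Triple) : Bool := Nat.ble v.1 c.1 && (Nat.ble v.2.1 c.2.1 && Nat.ble v.2.2 c.2.2)

/-- The sum of `z ^ diag A` over the blocks `A` with row sums `r` and column sums `c`,
in a form suited to evaluation; see `blockSum_eq`. -/
def blockSum (z : ℕ) (r c : Triple) : ℕ :=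
  boxSum r.1 fun v ↦ bif le v c then
    boxSum r.2.1 fun w ↦ bif le (v.1 + w.1, v.2.1 + w.2.1, v.2.2 + w.2.2) c then
        z ^ (v.1 + w.2.1 + (c.2.2 - (v.2.2 + w.2.2))) else 0
  else 0

def pairSum (x y k : ℕ) (r s : Triple) : ℕ :=
  boxSum k fun c ↦ blockSum x r c * blockSum y s (compl c)

def layerSum (x y k : ℕ) : ℕ :=
  boxSum k fun r ↦ boxSum (9 - k) fun s ↦
    pairSum x y k r s * pairSum x y k (compl s) (compl r)

/-- The generating function of the squares by the diagonal sum and the antidiagonal sum. -/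
def squareSum (x y : ℕ) : ℕ :=
  layerSum x y 0 + layerSum x y 1 + layerSum x y 2 + layerSum x y 3 + layerSum x y 4 +
  layerSum x y 5 + layerSum x y 6 + layerSum x y 7 + layerSum x y 8 + layerSum x y 9

lemma mem_box {v : Triple} : v ∈ box ↔ v.1 < 4 ∧ v.2.1 < 4 ∧ v.2.2 < 4 := by
  simp [box]

lemma compl_mem_box (v : Triple) : compl v ∈ box := by
  simp only [mem_box, compl]; omega

lemma compl_compl {v : Triple} (hv : v ∈ box) : compl (compl v) = v := by
  rw [mem_box] at hv
  ext <;> simp only [compl] <;> omega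

lemma total_compl {v : Triple} (hv : v ∈ box) : total (compl v) = 9 - total v := by
  rw [mem_box] at hv
  simp only [compl, total]; omega

lemma total_le {v : Triple} (hv : v ∈ box) : total v ≤ 9 := by
  rw [mem_box] at hv
  simp only [total]; omega

lemma boxSum_eq (k : ℕ) (f : Triple → ℕ) :
    boxSum k f = ∑ v ∈ box with total v = k, f v := by
  have key (a b : ℕ) : (bif Nat.ble (a + b) k then
      boxSum.pick (k - (a + b)) fun c ↦ f (a, b, c) else 0) =
      ∑ c ∈ range 4, if a + b + c = k then f (a, b, c) else 0 := by
    by_cases h : a + b ≤ k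
    · obtain ⟨m, rfl⟩ := Nat.exists_eq_add_of_le h
      rw [Nat.ble_eq_true_of_le h, Nat.add_sub_cancel_left]
      simp only [Nat.add_left_cancel_iff, cond_true]
      match m with
      | 0 | 1 | 2 | 3 => simp; rfl
      | m + 4 => exact (sum_eq_zero fun c hc ↦ if_neg (by rw [mem_range] at hc; omega)).symm
    · rw [sum_eq_zero]
      · have : Nat.ble (a + b) k = false := by
          rw [← Bool.not_eq_true, Nat.ble_eq]; exact h
        simp [this]
      · intro c _
        rw [if_neg (by omega)]
  have sum4_eq (g : ℕ → ℕ) : boxSum.sum4 g = ∑ a ∈ range 4, g a := by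
    simp only [boxSum.sum4, sum_range_succ, sum_range_zero, zero_add]
  simp only [boxSum, key, sum4_eq]
  rw [sum_filter, box, sum_product]
  simp only [sum_product]
  rfl

lemma le_iff (v c : Triple) : le v c = true ↔ v ≤ c := by
  simp [le, Prod.le_def]

lemma blockSum_eq (z : ℕ) {r c : Triple} (hc : c ∈ box) (h : total r = total c) :
    blockSum z r c = ∑ A ∈ blocks with rowSums A = r ∧ colSums A = c, z ^ diag A := by
  rw [sum_filter, blocks_eq, sum_product]
  simp only [sum_product, blockSum, boxSum_eq, sum_filter]
  refine sum_congr rfl fun v _ ↦ ?_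
  by_cases hv : total v = r.1
  swap
  · simp [rowSums, Prod.ext_iff, hv]
  rw [if_pos hv]
  by_cases hvc : v ≤ c
  swap
  · rw [(Bool.not_eq_true _).mp (mt (le_iff v c).mp hvc), cond_false]
    symm
    refine sum_eq_zero fun w _ ↦ sum_eq_zero fun x _ ↦ if_neg fun hx ↦ hvc ?_
    rw [← hx.2]
    simp only [colSums, Prod.le_def, Prod.fst_add, Prod.snd_add]
    omega
  rw [(le_iff v c).mpr hvc, cond_true]
  refine sum_congr rfl fun w _ ↦ ?_
  by_cases hw : total w = r.2.1
  swap
  · simp [rowSums, Prod.ext_iff, hw]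
  rw [if_pos hw]
  by_cases hwc : v + w ≤ c
  · rw [(le_iff (v.1 + w.1, v.2.1 + w.2.1, v.2.2 + w.2.2) c).mpr hwc, cond_true]
    simp only [mem_box] at hc
    simp only [Prod.le_def, Prod.fst_add, Prod.snd_add] at hwc
    simp only [total] at h hv hw
    rw [sum_eq_single (c.1 - (v.1 + w.1), c.2.1 - (v.2.1 + w.2.1), c.2.2 - (v.2.2 + w.2.2))]
    · rw [if_pos]
      · rfl
      · simp only [rowSums, colSums, total, Prod.ext_iff, Prod.fst_add, Prod.snd_add]
        omega
    · intro x _ hx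
      rw [if_neg]
      contrapose! hx
      simp only [colSums, Prod.ext_iff, Prod.fst_add, Prod.snd_add] at hx ⊢
      omega
    · intro hx
      refine absurd ?_ hx
      rw [mem_box]
      dsimp only
      omega
  · rw [(Bool.not_eq_true _).mp
      (mt (le_iff (v.1 + w.1, v.2.1 + w.2.1, v.2.2 + w.2.2) c).mp hwc), cond_false]
    symm
    refine sum_eq_zero fun x _ ↦ if_neg fun hx ↦ hwc ?_
    rw [← hx.2]
    simp only [colSums, Prod.le_def, Prod.fst_add, Prod.snd_add]
    omega

lemma total_rowSums (A : Block) : total (rowSums A) = total (colSums A) := by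
  simp only [total, rowSums, colSums, Prod.fst_add, Prod.snd_add]
  omega

/-- The generating function of the blocks with given margins by their diagonal sum. -/
def marginSum (z : ℕ) (r c : Triple) : ℕ :=
  ∑ A ∈ blocks, if rowSums A = r ∧ colSums A = c then z ^ diag A else 0

lemma marginSum_eq_zero (z : ℕ) {r c : Triple} (h : total r ≠ total c) : marginSum z r c = 0 := by
  refine sum_eq_zero fun A _ ↦ if_neg ?_
  rintro ⟨rfl, rfl⟩
  exact h (total_rowSums A)

lemma pairSum_eq (x y : ℕ) {r s : Triple} (h : total r + total s = 9) :
    pairSum x y (total r) r s = ∑ c ∈ box, marginSum x r c * marginSum y s (compl c) := by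
  rw [pairSum, boxSum_eq, sum_filter]
  refine sum_congr rfl fun c hc ↦ ?_
  split_ifs with hrc
  · rw [blockSum_eq x hc hrc.symm, blockSum_eq y (compl_mem_box c)
      (by rw [total_compl hc]; omega), sum_filter, sum_filter, marginSum, marginSum]
  · rw [marginSum_eq_zero x (Ne.symm hrc), zero_mul]

lemma layerSum_eq (x y k : ℕ) :
    layerSum x y k = ∑ r ∈ box with total r = k, ∑ s ∈ box,
      (∑ c ∈ box, marginSum x r c * marginSum y s (compl c)) *
        ∑ c ∈ box, marginSum x (compl s) c * marginSum y (compl r) (compl c) := by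
  rw [layerSum, boxSum_eq]
  refine sum_congr rfl fun r hrk ↦ ?_
  obtain ⟨hr, rfl⟩ := mem_filter.mp hrk
  rw [boxSum_eq, sum_filter]
  refine sum_congr rfl fun s hs ↦ ?_
  have hr9 := total_le hr
  have hs9 := total_le hs
  split_ifs with h
  · have hs' : total (compl s) = total r := by rw [total_compl hs]; omega
    rw [pairSum_eq x y (by omega), ← hs', pairSum_eq x y (by rw [hs', total_compl hr]; omega)]
  · rw [sum_eq_zero (s := box) (f := fun c ↦ marginSum x r c * marginSum y s (compl c)), zero_mul]
    intro c hc
    by_cases hrc : total r = total c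
    · rw [marginSum_eq_zero y (r := s), mul_zero]
      rw [total_compl hc]
      omega
    · rw [marginSum_eq_zero x hrc, zero_mul]

lemma squareSum_eq (x y : ℕ) :
    squareSum x y = ∑ r ∈ box, ∑ s ∈ box, ∑ c ∈ box, ∑ d ∈ box,
      marginSum x r c * marginSum y s (compl c) *
        (marginSum x (compl s) (compl d) * marginSum y (compl r) d) := by
  have h : squareSum x y = ∑ k ∈ range 10, layerSum x y k := by
    simp only [squareSum, sum_range_succ, sum_range_zero, zero_add]
  simp only [h, layerSum_eq]
  rw [sum_fiberwise_of_maps_to (g := total) fun r hr ↦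
    mem_range.mpr (Nat.lt_succ_of_le (total_le hr))]
  refine sum_congr rfl fun r _ ↦ sum_congr rfl fun s _ ↦ ?_
  rw [sum_mul_sum]
  refine sum_congr rfl fun c _ ↦ ?_
  refine sum_nbij' compl compl (fun d _ ↦ compl_mem_box d) (fun d _ ↦ compl_mem_box d)
    (fun d hd ↦ compl_compl hd) (fun d hd ↦ compl_compl hd) fun d hd ↦ ?_
  rw [compl_compl hd]

/-- Splitting the condition that two margins add up to `3`. -/
lemma ite_add_eq (u v : Triple) :
    (if u + v = (3, 3, 3) then 1 else 0) =
      ∑ r ∈ box, if u = r ∧ v = compl r then 1 else 0 := by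
  split_ifs with h
  · simp only [Prod.ext_iff, Prod.fst_add, Prod.snd_add] at h
    rw [sum_eq_single u]
    · rw [if_pos]
      simp only [Prod.ext_iff, compl, true_and]
      omega
    · rintro r _ hr
      rw [if_neg fun hu ↦ hr hu.1.symm]
    · intro hu
      refine absurd ?_ hu
      rw [mem_box]
      omega
  · symm
    refine sum_eq_zero fun r hr ↦ if_neg ?_
    rintro ⟨rfl, rfl⟩
    apply h
    rw [mem_box] at hr
    simp only [Prod.ext_iff, Prod.fst_add, Prod.snd_add, compl]
    omega

/-- The `6 × 6` matrices with entries at most `3` and all row and column sums `3`, split into four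
blocks. The top right block is stored with its columns reversed, the bottom left one with its rows
reversed, and the bottom right one with both reversed. -/
def squares : Finset (Block × Block × Block × Block) :=
  {Q ∈ blocks ×ˢ blocks ×ˢ blocks ×ˢ blocks |
    rowSums Q.1 + rowSums Q.2.1 = (3, 3, 3) ∧ colSums Q.1 + colSums Q.2.2.1 = (3, 3, 3) ∧
    rowSums Q.2.2.1 + rowSums Q.2.2.2 = (3, 3, 3) ∧ colSums Q.2.1 + colSums Q.2.2.2 = (3, 3, 3)}

lemma squares_eq : squares =
    {Q ∈ blocks ×ˢ blocks ×ˢ blocks ×ˢ blocks |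
    rowSums Q.1 + rowSums Q.2.1 = (3, 3, 3) ∧ colSums Q.1 + colSums Q.2.2.1 = (3, 3, 3) ∧
    rowSums Q.2.2.1 + rowSums Q.2.2.2 = (3, 3, 3) ∧ colSums Q.2.1 + colSums Q.2.2.2 = (3, 3, 3)} :=
  rfl

-- As for `blocks`.
attribute [irreducible] squares

lemma sum_mul_sum₄ (f₁ f₂ f₃ f₄ : Triple → ℕ) (n : ℕ) :
    (∑ v ∈ box, f₁ v) * ((∑ v ∈ box, f₂ v) * ((∑ v ∈ box, f₃ v) * ∑ v ∈ box, f₄ v)) * n =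
      ∑ m ∈ box ×ˢ box ×ˢ box ×ˢ box, f₁ m.1 * (f₂ m.2.1 * (f₃ m.2.2.1 * f₄ m.2.2.2)) * n := by
  simp only [sum_product, ← mul_sum, ← sum_mul]

lemma ite_and_eq (p q : Prop) [Decidable p] [Decidable q] (n : ℕ) :
    (if p ∧ q then n else 0) = (if p then 1 else 0) * (if q then 1 else 0) * n := by
  by_cases p <;> by_cases q <;> simp [*]

lemma sum_squares (x y : ℕ) :
    ∑ Q ∈ squares, x ^ (diag Q.1 + diag Q.2.2.2) * y ^ (diag Q.2.1 + diag Q.2.2.1) =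
      squareSum x y := by
  have h (Q : Block × Block × Block × Block) :
      (if rowSums Q.1 + rowSums Q.2.1 = (3, 3, 3) ∧ colSums Q.1 + colSums Q.2.2.1 = (3, 3, 3) ∧
          rowSums Q.2.2.1 + rowSums Q.2.2.2 = (3, 3, 3) ∧
          colSums Q.2.1 + colSums Q.2.2.2 = (3, 3, 3) then
        x ^ (diag Q.1 + diag Q.2.2.2) * y ^ (diag Q.2.1 + diag Q.2.2.1) else 0) =
      ∑ m ∈ box ×ˢ box ×ˢ box ×ˢ box,
        (if rowSums Q.1 = m.1 ∧ colSums Q.1 = m.2.2.1 then x ^ diag Q.1 else 0) *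
        (if rowSums Q.2.2.1 = m.2.1 ∧ colSums Q.2.2.1 = compl m.2.2.1 then
          y ^ diag Q.2.2.1 else 0) *
        ((if rowSums Q.2.2.2 = compl m.2.1 ∧ colSums Q.2.2.2 = compl m.2.2.2 then
          x ^ diag Q.2.2.2 else 0) *
        (if rowSums Q.2.1 = compl m.1 ∧ colSums Q.2.1 = m.2.2.2 then y ^ diag Q.2.1 else 0)) := by
    trans (∑ r ∈ box, if rowSums Q.1 = r ∧ rowSums Q.2.1 = compl r then 1 else 0) *
      ((∑ s ∈ box, if rowSums Q.2.2.1 = s ∧ rowSums Q.2.2.2 = compl s then 1 else 0) *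
      ((∑ c ∈ box, if colSums Q.1 = c ∧ colSums Q.2.2.1 = compl c then 1 else 0) *
      (∑ d ∈ box, if colSums Q.2.1 = d ∧ colSums Q.2.2.2 = compl d then 1 else 0))) *
      (x ^ (diag Q.1 + diag Q.2.2.2) * y ^ (diag Q.2.1 + diag Q.2.2.1))
    · simp only [← ite_add_eq]
      split_ifs <;> simp_all
    · rw [sum_mul_sum₄]
      refine sum_congr rfl fun m _ ↦ ?_
      simp only [ite_and_eq, pow_add]
      ring
  have hF (z : ℕ) (r c : Triple) : marginSum z r c =
    ∑ A ∈ blocks, if rowSums A = r ∧ colSums A = c then z ^ diag A else 0 := rfl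
  rw [squares_eq, sum_filter, sum_congr rfl fun Q _ ↦ h Q, sum_comm, squareSum_eq]
  simp only [sum_product]
  refine sum_congr rfl fun r _ ↦ sum_congr rfl fun s _ ↦ sum_congr rfl fun c _ ↦
    sum_congr rfl fun d _ ↦ ?_
  simp only [hF, sum_mul_sum]
  refine sum_congr rfl fun A _ ↦ ?_
  rw [sum_comm, sum_congr rfl fun C _ ↦ sum_comm, sum_comm]

/-- Reading off a coefficient from the value of a generating function at a large base. -/
lemma sum_pow_div_mod {ι : Type*} (S : Finset ι) (e : ι → ℕ) {b : ℕ} (k : ℕ) (hS : #S < b) :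
    (∑ i ∈ S, b ^ e i) / b ^ k % b = #{i ∈ S | e i = k} := by
  have hb : 0 < b := by omega
  obtain ⟨m, hm⟩ : b ^ (k + 1) ∣ ∑ i ∈ S with k < e i, b ^ e i :=
    dvd_sum fun i hi ↦ pow_dvd_pow b (mem_filter.mp hi).2
  have hlow : ∑ i ∈ S with e i < k, b ^ e i < b ^ k := by
    rcases k with _ | k
    · simp
    · calc ∑ i ∈ S with e i < k + 1, b ^ e i ≤ #{i ∈ S | e i < k + 1} * b ^ k := by
            rw [← smul_eq_mul]
            exact sum_le_card_nsmul _ _ _ fun i hi ↦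
              Nat.pow_le_pow_right hb (Nat.le_of_lt_succ (mem_filter.mp hi).2)
        _ ≤ #S * b ^ k := by gcongr; exact filter_subset _ _
        _ < b * b ^ k := by gcongr
        _ = b ^ (k + 1) := by ring
  have hmid : ∑ i ∈ S with e i = k, b ^ e i = #{i ∈ S | e i = k} * b ^ k := by
    rw [← smul_eq_mul]
    exact sum_eq_card_nsmul fun i hi ↦ by rw [(mem_filter.mp hi).2]
  have hsplit : ∑ i ∈ S, b ^ e i =
      ∑ i ∈ S with e i < k, b ^ e i + b ^ k * (#{i ∈ S | e i = k} + b * m) := by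
    have : ∑ i ∈ S, b ^ e i = ∑ i ∈ S with e i < k, b ^ e i +
        ∑ i ∈ S with e i = k, b ^ e i + ∑ i ∈ S with k < e i, b ^ e i := by
      simp only [sum_filter, ← sum_add_distrib]
      refine sum_congr rfl fun i _ ↦ ?_
      rcases lt_trichotomy (e i) k with h | h | h
      · simp [h, h.ne, h.not_gt]
      · simp [h]
      · simp [h, h.ne', h.not_gt]
    rw [this, hmid, hm]
    ring
  rw [hsplit, Nat.add_mul_div_left _ _ (by positivity), Nat.div_eq_of_lt hlow, zero_add,
    Nat.add_mul_mod_self_left,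
    Nat.mod_eq_of_lt ((card_le_card (filter_subset _ _)).trans_lt hS)]

lemma diag_le {A : Block} (hA : A ∈ blocks) : diag A ≤ 9 := by
  simp only [blocks_eq, mem_product, mem_box] at hA
  obtain ⟨⟨h₁, -, -⟩, ⟨-, h₂, -⟩, -, -, h₃⟩ := hA
  simp only [diag]
  omega

lemma squareSum_pow (b n : ℕ) :
    squareSum b (b ^ n) = ∑ Q ∈ squares,
      b ^ (diag Q.1 + diag Q.2.2.2 + n * (diag Q.2.1 + diag Q.2.2.1)) := by
  rw [← sum_squares]
  simp only [← pow_mul, ← pow_add]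

lemma card_squares_lt : #squares < 2 ^ 73 := by
  rw [squares_eq]
  refine (card_filter_le _ _).trans_lt ?_
  simp only [blocks_eq, box, card_product, card_range]
  norm_num

lemma diag_add_eq_iff {Q : Block × Block × Block × Block} (hQ : Q ∈ squares) :
    diag Q.1 + diag Q.2.2.2 + 19 * (diag Q.2.1 + diag Q.2.2.1) = 60 ↔
      diag Q.1 + diag Q.2.2.2 = 3 ∧ diag Q.2.1 + diag Q.2.2.1 = 3 := by
  simp only [squares_eq, mem_filter, mem_product] at hQ
  have h₁ := diag_le hQ.1.1
  have h₂ := diag_le hQ.1.2.2.2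
  omega

lemma card_squares_filter {b : ℕ} (hb : #squares < b) :
    #{Q ∈ squares | diag Q.1 + diag Q.2.2.2 = 3 ∧ diag Q.2.1 + diag Q.2.2.1 = 3} =
      squareSum b (b ^ 19) / b ^ 60 % b := by
  rw [squareSum_pow, sum_pow_div_mod squares _ 60 hb]
  exact congrArg card (filter_congr fun Q hQ ↦ (diag_add_eq_iff hQ).symm)

lemma squareSum_div_mod :
    squareSum (2 ^ 73) ((2 ^ 73) ^ 19) / (2 ^ 73) ^ 60 % 2 ^ 73 = 957936 := by
  decide +kernel

/-- The decomposition of a `6 × 6` matrix underlying `squares`. -/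
def toBlocks (M : Fin 6 → Fin 6 → ℕ) : Block × Block × Block × Block :=
  (((M 0 0, M 0 1, M 0 2), (M 1 0, M 1 1, M 1 2), (M 2 0, M 2 1, M 2 2)),
   ((M 0 5, M 0 4, M 0 3), (M 1 5, M 1 4, M 1 3), (M 2 5, M 2 4, M 2 3)),
   ((M 5 0, M 5 1, M 5 2), (M 4 0, M 4 1, M 4 2), (M 3 0, M 3 1, M 3 2)),
   ((M 5 5, M 5 4, M 5 3), (M 4 5, M 4 4, M 4 3), (M 3 5, M 3 4, M 3 3)))

/-- The inverse of `toBlocks`. -/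
def ofBlocks : Block × Block × Block × Block → Fin 6 → Fin 6 → ℕ
  | (A, B, C, D) =>
    ![row A.1 B.1, row A.2.1 B.2.1, row A.2.2 B.2.2, row C.2.2 D.2.2, row C.2.1 D.2.1, row C.1 D.1]
where
  row (v w : Triple) : Fin 6 → ℕ := ![v.1, v.2.1, v.2.2, w.2.2, w.2.1, w.1]

lemma toBlocks_ofBlocks (Q : Block × Block × Block × Block) : toBlocks (ofBlocks Q) = Q := rfl

lemma ofBlocks_toBlocks (M : Fin 6 → Fin 6 → ℕ) : ofBlocks (toBlocks M) = M := by
  funext i j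
  fin_cases i <;> fin_cases j <;> rfl

lemma toBlocks_mem_iff (M : Fin 6 → Fin 6 → ℕ) :
    ((∀ i, ∑ j, M i j = 3) ∧ (∀ j, ∑ i, M i j = 3) ∧
        (∑ i, M i i = 3) ∧ (∑ i, M i i.rev = 3)) ↔
      toBlocks M ∈ ({Q ∈ squares | diag Q.1 + diag Q.2.2.2 = 3 ∧ diag Q.2.1 + diag Q.2.2.1 = 3} :
        Finset _) := by
  have hrev : ∑ i, M i i.rev = M 0 5 + M 1 4 + M 2 3 + M 3 2 + M 4 1 + M 5 0 :=
    Fin.sum_univ_six _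
  simp only [squares_eq, blocks_eq, mem_filter, mem_product, mem_box, toBlocks, rowSums, colSums,
    total, diag, Prod.mk_add_mk, Prod.mk.injEq, hrev]
  constructor
  · rintro ⟨hr, hc, hd, ha⟩
    have hb (i j : Fin 6) : M i j < 4 := Nat.lt_succ_of_le <|
      (single_le_sum (fun _ _ ↦ Nat.zero_le _) (mem_univ j)).trans_eq (hr i)
    simp only [hb, and_self, true_and]
    simp only [Fin.sum_univ_six] at hr hc hd
    exact ⟨⟨⟨.trans (by ring) (hr 0), .trans (by ring) (hr 1), .trans (by ring) (hr 2)⟩,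
      ⟨.trans (by ring) (hc 0), .trans (by ring) (hc 1), .trans (by ring) (hc 2)⟩,
      ⟨.trans (by ring) (hr 5), .trans (by ring) (hr 4), .trans (by ring) (hr 3)⟩,
      .trans (by ring) (hc 5), .trans (by ring) (hc 4), .trans (by ring) (hc 3)⟩,
      .trans (by ring) hd, .trans (by ring) ha⟩
  · rintro ⟨⟨-, ⟨hr₀, hr₁, hr₂⟩, ⟨hc₀, hc₁, hc₂⟩, ⟨hr₅, hr₄, hr₃⟩, hc₅, hc₄, hc₃⟩, hd, ha⟩
    simp only [Fin.sum_univ_six]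
    refine ⟨fun i ↦ ?_, fun j ↦ ?_, .trans (by ring) hd, .trans (by ring) ha⟩
    · match i with
      | 0 => exact .trans (by ring) hr₀
      | 1 => exact .trans (by ring) hr₁
      | 2 => exact .trans (by ring) hr₂
      | 3 => exact .trans (by ring) hr₃
      | 4 => exact .trans (by ring) hr₄
      | 5 => exact .trans (by ring) hr₅
    · match j with
      | 0 => exact .trans (by ring) hc₀
      | 1 => exact .trans (by ring) hc₁
      | 2 => exact .trans (by ring) hc₂
      | 3 => exact .trans (by ring) hc₃
      | 4 => exact .trans (by ring) hc₄
      | 5 => exact .trans (by ring) hc₅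

end MagicSquare

open MagicSquare in
/-- Section 5.2: the number of 6 × 6 magic squares with natural number entries
and magic sum 3 (all row sums, column sums, the main diagonal sum and the
antidiagonal sum equal to 3) is 957936. -/
theorem stmt_15 :
    {M : Fin 6 → Fin 6 → ℕ |
        (∀ i, ∑ j, M i j = 3) ∧ (∀ j, ∑ i, M i j = 3) ∧
        (∑ i, M i i = 3) ∧ (∑ i, M i i.rev = 3)}.ncard = 957936 := by
  simp only [toBlocks_mem_iff]
  rw [← squareSum_div_mod, ← card_squares_filter card_squares_lt, ← Set.ncard_coe_finset]
  exact Set.ncard_preimage_of_injective_subset_range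
    (Function.LeftInverse.injective ofBlocks_toBlocks) fun Q _ ↦ ⟨ofBlocks Q, toBlocks_ofBlocks Q⟩
end
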